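/- arXiv:2204.11607 — 2 statements merged into one kernel-verified Lean document; each statement's English description precedes it below -/
import Mathlib

section
/- Let H ∈ ℤ[x,y,z] be a non-singular homogeneous form of degree d ≥ 2. Then there is a constant c_d depending only on d such that for all real numbers α, ζ, η and all reals B₁, B₂, B₃ ≥ 1, the number of triples (x,y,z) ∈ ℤ³ with gcd(x,y,z) = 1 satisfying H(x,y,z) = 0, |x − α·z| ≤ B₁, |y − ζ·x − η·z| ≤ B₂ and |z| ≤ B₃ is at most c_d·(B₁·B₂·B₃)^{1/3}. -/
namespace PlaneCurve

section Branches

open Filter Topology Set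

variable {f fs ft : ℝ × ℝ → ℝ}

/-- The zeros of `f` in the vertical strip over `[a, c]` with second coordinate in `[-1, 1]`. -/
def stripZeros (f : ℝ × ℝ → ℝ) (a c : ℝ) : Set (ℝ × ℝ) :=
  {p | p.1 ∈ Icc a c ∧ p.2 ∈ Icc (-1) 1 ∧ f p = 0}

/-- The projection of the zeros in a strip to the base interval. -/
def stripProj (f : ℝ × ℝ → ℝ) (a c : ℝ) : stripZeros f a c → Icc a c :=
  fun p => ⟨p.1.1, p.2.1⟩

lemma exists_local_graph
    (hf : ∀ p, HasStrictFDerivAt f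
      (fs p • ContinuousLinearMap.fst ℝ ℝ ℝ + ft p • ContinuousLinearMap.snd ℝ ℝ ℝ) p)
    {p : ℝ × ℝ} (hp : f p = 0) (hft : ft p ≠ 0) :
    ∃ φ : ℝ → ℝ, HasDerivAt φ (-(fs p / ft p)) p.1 ∧ φ p.1 = p.2 ∧
      (∀ᶠ v in 𝓝 p, f v = 0 ↔ φ v.1 = v.2) ∧ ∀ᶠ s in 𝓝 p.1, f (s, φ s) = 0 := by
  have hinv : ((fs p • ContinuousLinearMap.fst ℝ ℝ ℝ + ft p • ContinuousLinearMap.snd ℝ ℝ ℝ)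
      ∘L .inr ℝ ℝ ℝ).IsInvertible := by
    refine ⟨ContinuousLinearEquiv.unitsEquivAut ℝ (Units.mk0 _ hft), ?_⟩
    ext; simp
  have h1 := (hf p).eventually_apply_eq_iff_implicitFunctionOfProdDomain hinv
  have h2 := (hf p).eventually_apply_implicitFunctionOfProdDomain hinv
  have h3 := ((hf p).hasStrictFDerivAt_implicitFunctionOfProdDomain hinv).hasFDerivAt
  have h4 := h1.self_of_nhds.mp rfl
  rw [hp] at h1 h2
  generalize (hf p).implicitFunctionOfProdDomain hinv = φ at h1 h2 h3 h4
  obtain ⟨m, h5⟩ : ∃ m, HasDerivAt φ m p.1 := ⟨_, h3.hasDerivAt⟩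
  refine ⟨φ, ?_, h4, h1, h2⟩
  have h6 : ∀ᶠ s in 𝓝 p.1, (fun s => f (s, φ s)) s = (fun _ => (0 : ℝ)) s := h2
  have h7 : HasDerivAt (fun s => f (s, φ s)) 0 p.1 :=
    (hasDerivAt_const p.1 (0 : ℝ)).congr_of_eventuallyEq h6
  have h8 := (hf p).hasFDerivAt
  have h9 : p = (p.1, φ p.1) := by rw [h4]
  rw [h9] at h8
  have h10 := h8.comp_hasDerivAt p.1 ((hasDerivAt_id p.1).prodMk h5)
  have h11 := h7.unique h10
  rw [← h9] at h11
  simp only [add_apply, smul_apply, ContinuousLinearMap.coe_fst', ContinuousLinearMap.coe_snd',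
    smul_eq_mul] at h11
  have : m = -(fs p / ft p) := by
    field_simp
    linarith
  rwa [← this]

lemma isCoveringMap_stripProj {a c : ℝ}
    (hf : ∀ p, HasStrictFDerivAt f
      (fs p • ContinuousLinearMap.fst ℝ ℝ ℝ + ft p • ContinuousLinearMap.snd ℝ ℝ ℝ) p)
    (hreg : ∀ p ∈ stripZeros f a c, |p.2| < 1 ∧ ft p ≠ 0) :
    IsCoveringMap (stripProj f a c) := by
  have hfc : Continuous f := continuous_iff_continuousAt.2 fun p => (hf p).continuousAt
  have hcomp : IsCompact (stripZeros f a c) := by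
    have : stripZeros f a c = (Icc a c ×ˢ Icc (-1) 1) ∩ f ⁻¹' {0} := by
      ext p; simp only [stripZeros, mem_ofPred_eq, mem_inter_iff, mem_prod, and_assoc]; rfl
    rw [this]
    exact (isCompact_Icc.prod isCompact_Icc).inter_right (isClosed_singleton.preimage hfc)
  have : CompactSpace (stripZeros f a c) := isCompact_iff_compactSpace.1 hcomp
  have hcont : Continuous (stripProj f a c) := by unfold stripProj; fun_prop
  rw [← isLocalHomeomorph_iff_isCoveringMap]
  have hopen : IsOpenMap (stripProj f a c) := by
    rw [isOpenMap_iff_nhds_le]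
    rintro ⟨p, hp⟩ A hA
    obtain ⟨φ, hφ, hφp, -, h2⟩ := exists_local_graph hf hp.2.2 (hreg p hp).2
    rw [mem_map, mem_nhds_subtype] at hA
    obtain ⟨W, hW, hWA⟩ := hA
    have hc : Tendsto (fun s => (s, φ s)) (𝓝 p.1) (𝓝 p) := by
      have : Tendsto (fun s => (s, φ s)) (𝓝 p.1) (𝓝 (p.1, φ p.1)) :=
        tendsto_id.prodMk_nhds hφ.continuousAt
      rwa [hφp] at this
    have h1 : ∀ᶠ v : ℝ × ℝ in 𝓝 p, |v.2| < 1 :=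
      (continuous_snd.abs.tendsto p).eventually_lt_const (hreg p hp).1
    rw [mem_nhds_subtype]
    refine ⟨_, (hc.eventually hW).and ((hc.eventually h1).and h2), ?_⟩
    rintro ⟨s, hs⟩ ⟨hs1, hs2, hs3⟩
    have hE : (s, φ s) ∈ stripZeros f a c := ⟨hs, abs_le.1 hs2.le, hs3⟩
    exact hWA (show (⟨(s, φ s), hE⟩ : stripZeros f a c) ∈ _ from hs1)
  rw [isLocalHomeomorph_iff_isOpenEmbedding_restrict]
  rintro ⟨p, hp⟩
  obtain ⟨φ, -, -, h1, -⟩ := exists_local_graph hf hp.2.2 (hreg p hp).2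
  obtain ⟨U, hU, hUo, hpU⟩ := eventually_nhds_iff.1 h1
  have hUo' : IsOpen {e : stripZeros f a c | e.1 ∈ U} := hUo.preimage continuous_subtype_val
  refine ⟨{e : stripZeros f a c | e.1 ∈ U}, hUo'.mem_nhds hpU, ?_⟩
  refine .of_continuous_injective_isOpenMap (hcont.comp continuous_subtype_val) ?_
    (hopen.domRestrict hUo')
  rintro ⟨⟨x, hx⟩, hxU⟩ ⟨⟨y, hy⟩, hyU⟩ hxy
  have hxy1 : x.1 = y.1 := congrArg Subtype.val hxy
  have := (hU x hxU).1 hx.2.2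
  have := (hU y hyU).1 hy.2.2
  ext
  · exact hxy1
  · simp_all

/-- Each zero in a strip without critical points lies on a unique continuous branch, and the
branches are pairwise disjoint. -/
lemma exists_branches {a c : ℝ} (hac : a ≤ c)
    (hf : ∀ p, HasStrictFDerivAt f
      (fs p • ContinuousLinearMap.fst ℝ ℝ ℝ + ft p • ContinuousLinearMap.snd ℝ ℝ ℝ) p)
    (hreg : ∀ p ∈ stripZeros f a c, |p.2| < 1 ∧ ft p ≠ 0) :
    ∃ g : ℝ → ℝ → ℝ, ∀ p ∈ stripZeros f a c, ∃ t, f (a, t) = 0 ∧ |t| ≤ 1 ∧ g t p.1 = p.2 ∧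
      Continuous (g t) ∧ ∀ s ∈ Icc a c, (s, g t s) ∈ stripZeros f a c := by
  have hcov := isCoveringMap_stripProj hf hreg
  let q : C(ℝ, Icc a c) := ⟨projIcc a c hac, continuous_projIcc⟩
  have hq : ∀ s (hs : s ∈ Icc a c), q s = ⟨s, hs⟩ := fun s hs => projIcc_of_mem hac hs
  have key : ∀ (e : stripZeros f a c), ∃! F : C(ℝ, stripZeros f a c),
      F e.1.1 = e ∧ stripProj f a c ∘ F = q := fun e =>
    hcov.existsUnique_continuousMap_lifts q e.1.1 e (hq _ e.2.1).symm
  classical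
  let L : ℝ → ℝ → ℝ := fun t => if h : (a, t) ∈ stripZeros f a c then
    fun s => ((key ⟨(a, t), h⟩).choose s).1.2 else 0
  refine ⟨L, fun p hp => ?_⟩
  obtain ⟨F, ⟨hF1, hF2⟩, -⟩ := key ⟨p, hp⟩
  have haI : a ∈ Icc a c := left_mem_Icc.2 hac
  have hfst : ∀ F : C(ℝ, stripZeros f a c), stripProj f a c ∘ F = q → ∀ s ∈ Icc a c,
      (F s).1.1 = s := by
    intro F hF s hs
    have := congrArg Subtype.val (congrFun hF s)
    rw [hq s hs] at this
    exact this
  have hFa : ((a, (F a).1.2) : ℝ × ℝ) = (F a).1 := Prod.ext (hfst F hF2 a haI).symm rfl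
  have hmem : ((a, (F a).1.2) : ℝ × ℝ) ∈ stripZeros f a c := by rw [hFa]; exact (F a).2
  have hspec := (key ⟨_, hmem⟩).choose_spec
  have hFe : F = (key ⟨_, hmem⟩).choose := hspec.2 F ⟨Subtype.ext hFa.symm, hF2⟩
  have hL : L (F a).1.2 = fun s => (F s).1.2 := by
    simp only [L, dif_pos hmem]
    rw [← hFe]
  refine ⟨(F a).1.2, hmem.2.2, abs_le.2 hmem.2.1, ?_, ?_, ?_⟩
  · rw [hL]; exact congrArg (fun e : stripZeros f a c => e.1.2) hF1
  · rw [hL]; fun_prop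
  · intro s hs
    rw [hL]
    have : ((s, (F s).1.2) : ℝ × ℝ) = (F s).1 := Prod.ext (hfst F hF2 s hs).symm rfl
    show ((s, (F s).1.2) : ℝ × ℝ) ∈ _
    rw [this]; exact (F s).2

end Branches

section Counting

open Filter Topology Set

variable {f fs ft : ℝ × ℝ → ℝ}

/-- Twice the signed area of a triangle in the plane. -/
def area (p q r : ℝ × ℝ) : ℝ := (q.1 - p.1) * (r.2 - p.2) - (r.1 - p.1) * (q.2 - p.2)

lemma exists_slope_cell {q : ℝ → ℝ} {a c : ℝ} {N : ℕ} (hN : 1 ≤ N) (hq : ContinuousOn q (Icc a c))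
    (hav : ∀ s ∈ Icc a c, ∀ j : ℤ, |j| ≤ N → q s ≠ j / N) {s₀ : ℝ} (hs₀ : s₀ ∈ Icc a c)
    (h₀ : |q s₀| ≤ 1) :
    ∃ k : ℝ, ∀ s ∈ Icc a c, k < q s ∧ q s < k + 1 / N := by
  have hN0 : (0 : ℝ) < N := by exact_mod_cast hN
  set k : ℤ := ⌊N * q s₀⌋ with hk
  have h1 : (k : ℝ) ≤ N * q s₀ := Int.floor_le _
  have h2 : N * q s₀ < k + 1 := Int.lt_floor_add_one _
  obtain ⟨h3, h4⟩ := abs_le.1 h₀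
  have hkl : -(N : ℤ) ≤ k := by
    rw [hk, Int.le_floor]; push_cast; nlinarith
  have hne : q s₀ ≠ 1 := by
    have := hav s₀ hs₀ N (by simp)
    rwa [Int.cast_natCast, div_self hN0.ne'] at this
  have hku : k + 1 ≤ (N : ℤ) := by
    have : q s₀ < 1 := lt_of_le_of_ne h4 hne
    rw [Int.add_one_le_iff, hk, Int.floor_lt]; push_cast; nlinarith
  have hconn : (q '' Icc a c).OrdConnected := (isPreconnected_Icc.image q hq).ordConnected
  have hm₀ := mem_image_of_mem q hs₀
  refine ⟨k / N, fun s hs => ?_⟩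
  have hm := mem_image_of_mem q hs
  constructor
  · by_contra! h
    obtain ⟨x, hx, hxk⟩ := hconn.out hm hm₀ ⟨h, by rw [div_le_iff₀ hN0]; linarith⟩
    exact hav x hx k (abs_le.2 ⟨hkl, by omega⟩) hxk
  · rw [← add_div]
    by_contra! h
    obtain ⟨x, hx, hxk⟩ := hconn.out hm₀ hm ⟨by rw [le_div_iff₀ hN0]; linarith, h⟩
    exact hav x hx (k + 1) (abs_le.2 ⟨by omega, hku⟩) (by push_cast; exact hxk)

lemma chord_slope_mem {g q : ℝ → ℝ} {a c l u : ℝ} (hg : ContinuousOn g (Icc a c))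
    (hg' : ∀ s ∈ Ioo a c, HasDerivAt g (q s) s) (hq : ∀ s ∈ Icc a c, l < q s ∧ q s < u)
    {x y : ℝ} (hx : x ∈ Icc a c) (hy : y ∈ Icc a c) (hxy : x ≠ y) :
    ∃ m, g y - g x = m * (y - x) ∧ l < m ∧ m < u := by
  wlog h : x < y generalizing x y
  · obtain ⟨m, hm, h'⟩ := this hy hx hxy.symm (lt_of_le_of_ne (not_lt.1 h) hxy.symm)
    exact ⟨m, by linarith, h'⟩
  obtain ⟨z, hz, hzm⟩ := exists_hasDerivAt_eq_slope g q h
    (hg.mono (Icc_subset_Icc hx.1 hy.2))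
    (fun s hs => hg' s ⟨hx.1.trans_lt hs.1, hs.2.trans_le hy.2⟩)
  refine ⟨q z, ?_, hq z ⟨hx.1.trans hz.1.le, hz.2.le.trans hy.2⟩⟩
  rw [hzm]
  field_simp [sub_ne_zero.2 h.ne']

lemma abs_area_lt {g q : ℝ → ℝ} {a c l δ : ℝ} (hδ : 0 < δ) (hac : c - a ≤ δ)
    (hg : ContinuousOn g (Icc a c))
    (hg' : ∀ s ∈ Ioo a c, HasDerivAt g (q s) s) (hq : ∀ s ∈ Icc a c, l < q s ∧ q s < l + δ)
    {x y z : ℝ} (hx : x ∈ Icc a c) (hy : y ∈ Icc a c) (hz : z ∈ Icc a c) :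
    |area (x, g x) (y, g y) (z, g z)| < δ ^ 3 := by
  have hδ3 : 0 < δ ^ 3 := by positivity
  by_cases hxy : x = y
  · subst hxy; simpa [area] using hδ3
  by_cases hxz : x = z
  · subst hxz; simpa [area] using hδ3
  obtain ⟨m, hm, hm1, hm2⟩ := chord_slope_mem hg hg' hq hx hy hxy
  obtain ⟨n, hn, hn1, hn2⟩ := chord_slope_mem hg hg' hq hx hz hxz
  have : area (x, g x) (y, g y) (z, g z) = (y - x) * (z - x) * (n - m) := by
    simp only [area, hm, hn]; ring
  rw [this, abs_mul, abs_mul]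
  have h1 : |y - x| ≤ δ := abs_le.2 ⟨by linarith [hx.2, hy.1], by linarith [hx.1, hy.2]⟩
  have h2 : |z - x| ≤ δ := abs_le.2 ⟨by linarith [hx.2, hz.1], by linarith [hx.1, hz.2]⟩
  have h3 : |n - m| < δ := abs_lt.2 ⟨by linarith, by linarith⟩
  calc |y - x| * |z - x| * |n - m| ≤ (δ * δ) * |n - m| := by gcongr
    _ < δ * δ * δ := by gcongr
    _ = δ ^ 3 := by ring

/-- A collinear set of zeros has at most `d` elements if no line contains more than `d` zeros. -/
lemma card_le_of_area_eq_zero {d : ℕ} (hd : 1 ≤ d)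
    (hL : ∀ p v : ℝ × ℝ, v ≠ 0 → ∃ Z : Finset ℝ, Z.card ≤ d ∧ ∀ τ : ℝ, f (p + τ • v) = 0 → τ ∈ Z)
    (S : Finset (ℝ × ℝ)) (hS : ∀ p ∈ S, f p = 0)
    (h : ∀ p ∈ S, ∀ q ∈ S, ∀ r ∈ S, area p q r = 0) : S.card ≤ d := by
  classical
  by_cases h1 : S.card ≤ 1
  · omega
  obtain ⟨p, hp, q, hq, hpq⟩ := Finset.one_lt_card.1 (not_le.1 h1)
  obtain ⟨Z, hZ, hZ'⟩ := hL p (q - p) (sub_ne_zero.2 hpq.symm)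
  have : S ⊆ Z.image fun τ => p + τ • (q - p) := by
    intro r hr
    have ha := h p hp q hq r hr
    have : ∃ τ : ℝ, p + τ • (q - p) = r := by
      simp only [area] at ha
      by_cases hx : q.1 - p.1 = 0
      · have hy : q.2 - p.2 ≠ 0 := fun hy => hpq (Prod.ext (by linarith) (by linarith))
        refine ⟨(r.2 - p.2) / (q.2 - p.2), Prod.ext ?_ ?_⟩
        · have : r.1 - p.1 = 0 := by
            rw [hx] at ha; simpa [hy] using ha
          simp [hx]; linarith
        · simp; field_simp; ring
      · refine ⟨(r.1 - p.1) / (q.1 - p.1), Prod.ext ?_ ?_⟩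
        · simp; field_simp; ring
        · simp; field_simp; linarith
    obtain ⟨τ, rfl⟩ := this
    exact Finset.mem_image_of_mem _ (hZ' τ (hS _ hr))
  exact (Finset.card_le_card this).trans (Finset.card_image_le.trans hZ)

/-- The zeros of a fixed vertical line. -/
lemma vertical_zeros {d : ℕ}
    (hL : ∀ p v : ℝ × ℝ, v ≠ 0 → ∃ Z : Finset ℝ, Z.card ≤ d ∧ ∀ τ : ℝ, f (p + τ • v) = 0 → τ ∈ Z)
    (s : ℝ) : ∃ Z : Finset ℝ, Z.card ≤ d ∧ ∀ t : ℝ, f (s, t) = 0 → t ∈ Z := by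
  obtain ⟨Z, hZ, hZ'⟩ := hL (s, 0) (0, 1) (by simp)
  exact ⟨Z, hZ, fun t ht => hZ' t (by simpa using ht)⟩

/-- Counting zeros of slope at most one over an interval avoiding all special abscissae. -/
lemma card_le_over_interval {d N : ℕ} (hd : 1 ≤ d) (hN : 1 ≤ N)
    (hf : ∀ p, HasStrictFDerivAt f
      (fs p • ContinuousLinearMap.fst ℝ ℝ ℝ + ft p • ContinuousLinearMap.snd ℝ ℝ ℝ) p)
    (hfs : Continuous fs) (hft : Continuous ft)
    (hL : ∀ p v : ℝ × ℝ, v ≠ 0 → ∃ Z : Finset ℝ, Z.card ≤ d ∧ ∀ τ : ℝ, f (p + τ • v) = 0 → τ ∈ Z)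
    {a c : ℝ} (hac : a ≤ c) (hacN : c - a ≤ 1 / N)
    (hreg : ∀ p ∈ stripZeros f a c, |p.2| < 1 ∧ ft p ≠ 0)
    (hslope : ∀ p ∈ stripZeros f a c, ∀ j : ℤ, |j| ≤ N → fs p + j / N * ft p ≠ 0)
    (S : Finset (ℝ × ℝ)) (hS : ∀ p ∈ S, p ∈ stripZeros f a c ∧ |fs p| ≤ |ft p|)
    (hdet : ∀ p ∈ S, ∀ q ∈ S, ∀ r ∈ S, area p q r = 0 ∨ 1 / (N : ℝ) ^ 3 ≤ |area p q r|) :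
    S.card ≤ d * d := by
  classical
  obtain ⟨g, hg⟩ := exists_branches hac hf hreg
  choose! lab hlab0 hlab1 hlabp hlabc hlabz using hg
  obtain ⟨Z, hZ, hZ'⟩ := vertical_zeros hL a
  refine (Finset.card_le_mul_card_image_of_maps_to (f := lab) (t := Z)
    (fun p hp => hZ' _ (hlab0 p (hS p hp).1)) d fun t _ => ?_).trans (by gcongr)
  refine card_le_of_area_eq_zero hd hL _
    (fun p hp => (hS p (Finset.mem_filter.1 hp).1).1.2.2) ?_
  intro p hp q hq r hr
  rw [Finset.mem_filter] at hp hq hr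
  obtain ⟨hpS, rfl⟩ := hp
  set G := g (lab p) with hG
  have hpz := (hS p hpS).1
  have hGc : Continuous G := hlabc p hpz
  have hGz : ∀ s ∈ Icc a c, (s, G s) ∈ stripZeros f a c := hlabz p hpz
  have hGp : ∀ x ∈ S, lab x = lab p → (x.1, G x.1) = x := fun x hx hxp =>
    Prod.ext rfl (by have := hlabp x (hS x hx).1; rw [hxp] at this; exact this)
  let Q : ℝ → ℝ := fun s => -(fs (s, G s) / ft (s, G s))
  have hQc : ContinuousOn Q (Icc a c) := by
    have h1 : Continuous fun s => (s, G s) := by fun_prop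
    exact ((hfs.comp h1).continuousOn.div (hft.comp h1).continuousOn
      fun s hs => (hreg _ (hGz s hs)).2).neg
  have hQav : ∀ s ∈ Icc a c, ∀ j : ℤ, |j| ≤ N → Q s ≠ j / N := by
    intro s hs j hj h
    have h1 := (hreg _ (hGz s hs)).2
    refine hslope _ (hGz s hs) j hj ?_
    rw [← h]; simp only [Q]; field_simp; ring
  have hQ0 : |Q p.1| ≤ 1 := by
    simp only [Q, hGp p hpS rfl]
    rw [abs_neg, abs_div]
    exact div_le_one_of_le₀ (hS p hpS).2 (abs_nonneg _)
  obtain ⟨k, hk⟩ := exists_slope_cell hN hQc hQav hpz.1 hQ0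
  have hder : ∀ s ∈ Ioo a c, HasDerivAt G (Q s) s := by
    intro s hs
    have hs' := hGz s (Ioo_subset_Icc_self hs)
    obtain ⟨φ, hφ, -, h1, -⟩ := exists_local_graph hf hs'.2.2 (hreg _ hs').2
    refine hφ.congr_of_eventuallyEq ?_
    have h2 : Tendsto (fun s => (s, G s)) (𝓝 s) (𝓝 (s, G s)) :=
      (show Continuous fun s => (s, G s) by fun_prop).tendsto s
    filter_upwards [h2.eventually h1, Ioo_mem_nhds hs.1 hs.2] with x hx hx'
    exact (hx.1 (hGz x (Ioo_subset_Icc_self hx')).2.2).symm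
  have hN0 : (0 : ℝ) < N := by exact_mod_cast hN
  have := abs_area_lt (one_div_pos.2 hN0) hacN hGc.continuousOn hder hk hpz.1 (hS q hq.1).1.1
    (hS r hr.1).1.1
  rw [hGp p hpS rfl, hGp q hq.1 hq.2, hGp r hr.1 hr.2, one_div_pow] at this
  exact (hdet p hpS q hq.1 r hr.1).resolve_right (not_le.2 this)

end Counting

section Shallow

open Filter Topology Set

variable {f fs ft : ℝ × ℝ → ℝ}

lemma exists_grid_point {N : ℕ} (hN : 1 ≤ N) {a c : ℝ} (ha : -1 ≤ a) (hc : c ≤ 1)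
    (hac : 1 / N < c - a) : ∃ j : ℤ, |j| ≤ N ∧ (j / N : ℝ) ∈ Icc a c := by
  have hN0 : (0 : ℝ) < N := by exact_mod_cast hN
  have h1 : (⌊N * a⌋ : ℝ) ≤ N * a := Int.floor_le _
  have h2 : N * a < ⌊N * a⌋ + 1 := Int.lt_floor_add_one _
  have h3 : 1 < N * (c - a) := by rw [div_lt_iff₀ hN0] at hac; linarith
  have h4 : -(N : ℤ) ≤ ⌊N * a⌋ := by
    rw [Int.le_floor]; push_cast; nlinarith
  have h5 : ((⌊N * a⌋ + 1 : ℤ) : ℝ) ≤ N := by push_cast; nlinarith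
  have h6 : ⌊N * a⌋ + 1 ≤ (N : ℤ) := by exact_mod_cast h5
  refine ⟨⌊N * a⌋ + 1, abs_le.2 ⟨by omega, h6⟩, ?_, ?_⟩
  · rw [le_div_iff₀ hN0]; push_cast; linarith
  · rw [div_le_iff₀ hN0]; push_cast; nlinarith

/-- The number of zeros of slope at most one in a well-spaced subset of the unit square. -/
lemma card_le_of_shallow {d K N : ℕ} (hd : 1 ≤ d) (hN : 1 ≤ N)
    (hf : ∀ p, HasStrictFDerivAt f
      (fs p • ContinuousLinearMap.fst ℝ ℝ ℝ + ft p • ContinuousLinearMap.snd ℝ ℝ ℝ) p)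
    (hfs : Continuous fs) (hft : Continuous ft)
    (hL : ∀ p v : ℝ × ℝ, v ≠ 0 → ∃ Z : Finset ℝ, Z.card ≤ d ∧ ∀ τ : ℝ, f (p + τ • v) = 0 → τ ∈ Z)
    (hV : ∃ Z : Finset ℝ, Z.card ≤ K ∧ ∀ p, f p = 0 → ft p = 0 → p.1 ∈ Z)
    (hT : ∀ m : ℝ, ∃ Z : Finset ℝ, Z.card ≤ K ∧ ∀ p, f p = 0 → fs p + m * ft p = 0 → p.1 ∈ Z)
    (S : Finset (ℝ × ℝ)) (hS : ∀ p ∈ S, |p.1| ≤ 1 ∧ |p.2| ≤ 1 ∧ f p = 0 ∧ |fs p| ≤ |ft p|)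
    (hdet : ∀ p ∈ S, ∀ q ∈ S, ∀ r ∈ S, area p q r = 0 ∨ 1 / (N : ℝ) ^ 3 ≤ |area p q r|) :
    S.card ≤ (3 + 2 * d + 4 * K) * (d + 2 * (d * d)) * N := by
  classical
  obtain ⟨Zu, hZu, hZu'⟩ := hL (0, 1) (1, 0) (by simp)
  obtain ⟨Zl, hZl, hZl'⟩ := hL (0, -1) (1, 0) (by simp)
  obtain ⟨Zv, hZv, hZv'⟩ := hV
  choose Zm hZm hZm' using hT
  choose W hW hW' using vertical_zeros hL
  set J : Finset ℤ := Finset.Icc (-N : ℤ) N with hJ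
  have hJcard : J.card ≤ 3 * N := by rw [hJ, Int.card_Icc]; omega
  have hJmem : ∀ j : ℤ, |j| ≤ N → j ∈ J := fun j hj => Finset.mem_Icc.2 (abs_le.1 hj)
  set X : Finset ℝ := (J.image fun j : ℤ => (j / N : ℝ)) ∪ (Zu ∪ Zl) ∪
    (Zv ∪ J.biUnion fun j => Zm (j / N)) with hX
  have hXcard : X.card ≤ (3 + 2 * d + 4 * K) * N := by
    have h1 : (J.image fun j : ℤ => (j / N : ℝ)).card ≤ 3 * N := Finset.card_image_le.trans hJcard
    have h2 : (J.biUnion fun j => Zm (j / N)).card ≤ 3 * N * K :=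
      (Finset.card_biUnion_le_card_mul _ _ K fun _ _ => hZm _).trans (by gcongr)
    have h3 : (Zu ∪ Zl).card ≤ 2 * d := (Finset.card_union_le _ _).trans (by omega)
    have h4 : X.card ≤ (3 * N + 2 * d) + (K + 3 * N * K) :=
      (Finset.card_union_le _ _).trans (add_le_add
        ((Finset.card_union_le _ _).trans (add_le_add h1 h3))
        ((Finset.card_union_le _ _).trans (add_le_add hZv h2)))
    nlinarith [Nat.mul_le_mul_left d hN, Nat.mul_le_mul_left K hN]
  have hX1 : 1 ≤ X.card := Finset.card_pos.2 ⟨((0 : ℤ) / N : ℝ), by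
    rw [hX]
    exact Finset.mem_union_left _ (Finset.mem_union_left _
      (Finset.mem_image_of_mem _ (hJmem 0 (by simp))))⟩
  have hgrid : ∀ j : ℤ, |j| ≤ N → (j / N : ℝ) ∈ X := fun j hj =>
    Finset.mem_union_left _ (Finset.mem_union_left _ (Finset.mem_image_of_mem _ (hJmem j hj)))
  have hXu : Zu ⊆ X := fun x hx =>
    Finset.mem_union_left _ (Finset.mem_union_right _ (Finset.mem_union_left _ hx))
  have hXl : Zl ⊆ X := fun x hx =>
    Finset.mem_union_left _ (Finset.mem_union_right _ (Finset.mem_union_right _ hx))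
  have hXv : Zv ⊆ X := fun x hx => Finset.mem_union_right _ (Finset.mem_union_left _ hx)
  have hXm : ∀ j : ℤ, |j| ≤ N → Zm (j / N) ⊆ X := fun j hj x hx =>
    Finset.mem_union_right _ (Finset.mem_union_right _ (Finset.mem_biUnion.2 ⟨j, hJmem j hj, hx⟩))
  clear_value X
  have hS1 : (S.filter fun p => p.1 ∈ X).card ≤ d * X.card := by
    refine Finset.card_le_mul_card_image_of_maps_to (f := Prod.fst)
      (fun p hp => (Finset.mem_filter.1 hp).2) d fun x _ => ?_
    refine (Finset.card_le_card_of_injOn Prod.snd (t := W x) ?_ ?_).trans (hW x)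
    · intro p hp
      simp only [Finset.coe_filter, Finset.mem_filter, mem_ofPred_eq] at hp
      refine hW' x p.2 ?_
      rw [← hp.2]
      exact (hS p hp.1.1).2.2.1
    · intro p hp q hq hpq
      simp only [Finset.coe_filter, Finset.mem_filter, mem_ofPred_eq] at hp hq
      exact Prod.ext (hp.2.trans hq.2.symm) hpq
  let idx : ℝ → ℕ := fun s => (X.filter (· < s)).card
  have hidx : ∀ s s', s ∉ X → s' ∉ X → idx s = idx s' → ∀ x ∈ X, x ∉ Icc s s' := by
    intro s s' hs hs' h x hx hxI
    have h1 : s < x := lt_of_le_of_ne hxI.1 (by rintro rfl; exact hs hx)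
    have h2 : x < s' := lt_of_le_of_ne hxI.2 (by rintro rfl; exact hs' hx)
    refine absurd h (Finset.card_lt_card ?_).ne
    rw [Finset.ssubset_iff_of_subset]
    · exact ⟨x, by simp [hx, h2], by simp [h1.le]⟩
    · intro y hy
      rw [Finset.mem_filter] at hy ⊢
      exact ⟨hy.1, hy.2.trans (h1.trans h2)⟩
  have hS2 : (S.filter fun p => p.1 ∉ X).card ≤ d * d * (X.card + 1) := by
    have := Finset.card_le_mul_card_image_of_maps_to (f := fun p : ℝ × ℝ => idx p.1)
      (s := S.filter fun p => p.1 ∉ X) (t := Finset.range (X.card + 1))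
      (fun p _ => Finset.mem_range.2 (Nat.lt_succ_of_le (Finset.card_filter_le _ _))) (d * d) ?_
    · rwa [Finset.card_range] at this
    intro k _
    set T := (S.filter fun p => p.1 ∉ X).filter fun p => idx p.1 = k with hT
    have hTm : ∀ p ∈ T, p ∈ S ∧ p.1 ∉ X ∧ idx p.1 = k := by
      intro p hp
      simpa [hT, and_assoc] using hp
    rcases T.eq_empty_or_nonempty with h0 | hne
    · simp [h0]
    obtain ⟨p, hp, hpmin⟩ := T.exists_min_image Prod.fst hne
    obtain ⟨q, hq, hqmax⟩ := T.exists_max_image Prod.fst hne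
    have hgap : ∀ x ∈ Icc p.1 q.1, x ∉ X := fun x hx hxX =>
      hidx p.1 q.1 (hTm p hp).2.1 (hTm q hq).2.1 ((hTm p hp).2.2.trans (hTm q hq).2.2.symm) x hxX hx
    refine card_le_over_interval (a := p.1) (c := q.1) hd hN hf hfs hft hL (hpmin q hq) ?_ ?_ ?_ T
      ?_ ?_
    · by_contra! h
      obtain ⟨j, hj, hjI⟩ := exists_grid_point hN (abs_le.1 (hS p (hTm p hp).1).1).1
        (abs_le.1 (hS q (hTm q hq).1).1).2 h
      exact hgap _ hjI (hgrid j hj)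
    · rintro ⟨s, t⟩ ⟨hs, ht, hst⟩
      refine ⟨lt_of_le_of_ne (abs_le.2 ht) fun h => ?_, fun h => hgap _ hs (hXv (hZv' _ hst h))⟩
      rcases (abs_eq (zero_le_one' ℝ)).1 h with h | h
      · exact hgap _ hs (hXu (hZu' _ (by simpa [show t = 1 from h] using hst)))
      · refine hgap _ hs (hXl (hZl' _ ?_))
        simpa [show t = -1 from h] using hst
    · rintro x ⟨hs, ht, hst⟩ j hj h
      exact hgap _ hs (hXm j hj (hZm' _ _ hst h))
    · intro x hx
      obtain ⟨h1, h2, h3, h4⟩ := hS x (hTm x hx).1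
      exact ⟨⟨⟨hpmin x hx, hqmax x hx⟩, abs_le.1 h2, h3⟩, h4⟩
    · exact fun x hx y hy z hz => hdet x (hTm x hx).1 y (hTm y hy).1 z (hTm z hz).1
  rw [← Finset.card_filter_add_card_filter_not (fun p : ℝ × ℝ => p.1 ∈ X)]
  calc _ ≤ d * X.card + d * d * (X.card + 1) := add_le_add hS1 hS2
    _ ≤ d * X.card + d * d * (2 * X.card) := by gcongr; omega
    _ = (d + 2 * (d * d)) * X.card := by ring
    _ ≤ (d + 2 * (d * d)) * ((3 + 2 * d + 4 * K) * N) := by gcongr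
    _ = _ := by ring

end Shallow

open Polynomial
open MvPolynomial (pderiv)

/-- Restriction of a polynomial to the parametrized line `τ ↦ p + τ q`. -/
noncomputable def linePoly {R ι : Type*} [CommRing R] (G : MvPolynomial ι R) (p q : ι → R) : R[X] :=
  MvPolynomial.aeval (fun i => C (p i) + C (q i) * X) G

section linePoly

variable {R ι : Type*} [CommRing R]

lemma eval_linePoly (G : MvPolynomial ι R) (p q : ι → R) (t : R) :
    (linePoly G p q).eval t = MvPolynomial.eval (fun i => p i + t * q i) G := by
  induction G using MvPolynomial.induction_on with
  | C a => simp [linePoly, Polynomial.algebraMap_eq]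
  | add f g hf hg => simp_all [linePoly]
  | mul_X f i hf => simp_all [linePoly, mul_comm t]

lemma map_linePoly {S : Type*} [CommRing S] (φ : R →+* S) (G : MvPolynomial ι R) (p q : ι → R) :
    (linePoly G p q).map φ = linePoly (MvPolynomial.map φ G) (fun i => φ (p i)) (fun i => φ (q i)) := by
  induction G using MvPolynomial.induction_on with
  | C a => simp [linePoly, Polynomial.algebraMap_eq]
  | add f g hf hg => simp_all [linePoly]
  | mul_X f i hf => simp_all [linePoly]

lemma derivative_linePoly [Fintype ι] (G : MvPolynomial ι R) (p q : ι → R) :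
    derivative (linePoly G p q) =
      ∑ i, C (q i) * linePoly (MvPolynomial.pderiv i G) p q := by
  classical
  induction G using MvPolynomial.induction_on with
  | C a => simp [linePoly, Polynomial.algebraMap_eq]
  | add f g hf hg => simp_all [linePoly, mul_add, Finset.sum_add_distrib]
  | mul_X f i hf =>
    have h1 : ∀ j, linePoly (MvPolynomial.pderiv j (f * MvPolynomial.X i)) p q
        = linePoly (MvPolynomial.pderiv j f) p q * (C (p i) + C (q i) * X)
          + (if i = j then linePoly f p q else 0) := by
      intro j
      rw [Derivation.leibniz, MvPolynomial.pderiv_X]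
      by_cases h : i = j
      · subst h
        simp [linePoly]
        ring
      · simp [linePoly, h]
        ring
    have h2 : linePoly (f * MvPolynomial.X i) p q
        = linePoly f p q * (C (p i) + C (q i) * X) := by simp [linePoly]
    rw [h2, derivative_mul, hf]
    simp only [h1, mul_add, Finset.sum_add_distrib, mul_ite, mul_zero, Finset.sum_ite_eq,
      Finset.mem_univ, if_true, Finset.sum_mul, derivative_add, derivative_mul, derivative_C,
      derivative_X, zero_mul, zero_add, mul_one, ← mul_assoc]
    rw [mul_comm (C (q i))]

lemma natDegree_linePoly_le {d : ℕ} {G : MvPolynomial ι R} (hG : G.IsHomogeneous d) (p q : ι → R) :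
    (linePoly G p q).natDegree ≤ d := by
  rw [linePoly, MvPolynomial.aeval_def, MvPolynomial.eval₂_eq]
  refine natDegree_sum_le_of_forall_le _ _ fun m hm => ?_
  rw [Polynomial.algebraMap_eq]
  refine (natDegree_C_mul_le _ _).trans ((natDegree_prod_le _ _).trans ?_)
  have h := hG (MvPolynomial.mem_support_iff.1 hm)
  rw [← h, Finsupp.weight_apply, Finsupp.sum]
  refine Finset.sum_le_sum fun i _ => ?_
  refine natDegree_pow_le.trans ?_
  simp only [Pi.one_apply, smul_eq_mul]
  refine Nat.mul_le_mul_left _ ?_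
  refine natDegree_add_le_of_degree_le (by simp) ?_
  exact (natDegree_C_mul_le _ _).trans natDegree_X_le

lemma eval_homogeneous_smul {d : ℕ} {G : MvPolynomial ι R} (hG : G.IsHomogeneous d)
    (c : R) (x : ι → R) :
    MvPolynomial.eval (fun i => c * x i) G = c ^ d * MvPolynomial.eval x G := by
  rw [MvPolynomial.eval_eq, MvPolynomial.eval_eq, Finset.mul_sum]
  refine Finset.sum_congr rfl fun m hm => ?_
  have h := hG (MvPolynomial.mem_support_iff.1 hm)
  rw [← h, Finsupp.weight_apply, Finsupp.sum]
  simp only [Pi.one_apply, smul_eq_mul, mul_one, mul_pow, Finset.prod_mul_distrib,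
    Finset.prod_pow_eq_pow_sum]
  ring

end linePoly

section Complex

lemma eq_zero_of_det_ne_zero {R : Type*} [CommRing R] [IsDomain R] {a b c g : Fin 3 → R}
    (hdet : (Matrix.of ![a, b, c]).det ≠ 0)
    (ha : ∑ i, a i * g i = 0) (hb : ∑ i, b i * g i = 0) (hc : ∑ i, c i * g i = 0) : g = 0 := by
  refine Matrix.eq_zero_of_mulVec_eq_zero hdet ?_
  ext i
  fin_cases i <;> simpa [Matrix.mulVec, dotProduct]

lemma combination_ne_zero {R : Type*} [CommRing R] [IsDomain R] {a b c : Fin 3 → R}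
    (hdet : (Matrix.of ![a, b, c]).det ≠ 0) (s t : R) :
    (fun i => a i + s * b i + t * c i) ≠ 0 := by
  intro h
  have := Matrix.eq_zero_of_vecMul_eq_zero (v := ![1, s, t]) hdet (by
    ext i
    have := congrFun h i
    simpa [Matrix.vecMul, dotProduct, Fin.sum_univ_three] using this)
  simpa using congrFun this 0

variable {d : ℕ} {G : MvPolynomial (Fin 3) ℂ}

lemma not_singular (hG : G.IsHomogeneous d)
    (hns : ∀ x : Fin 3 → ℂ, x ≠ 0 → ∃ i, MvPolynomial.eval x (pderiv i G) ≠ 0)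
    {a b c : Fin 3 → ℂ} (hdet : (Matrix.of ![a, b, c]).det ≠ 0) (s t : ℂ)
    (h0 : MvPolynomial.eval (fun i => a i + s * b i + t * c i) G = 0)
    (hb : ∑ j, b j * MvPolynomial.eval (fun i => a i + s * b i + t * c i) (pderiv j G) = 0)
    (hc : ∑ j, c j * MvPolynomial.eval (fun i => a i + s * b i + t * c i) (pderiv j G) = 0) :
    False := by
  obtain ⟨i, hi⟩ := hns _ (combination_ne_zero hdet s t)
  have heuler := congrArg (MvPolynomial.eval (fun i => a i + s * b i + t * c i))
    hG.sum_X_mul_pderiv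
  set x := fun i => a i + s * b i + t * c i with hx
  simp only [map_sum, map_mul, MvPolynomial.eval_X, map_nsmul, h0, smul_zero] at heuler
  refine hi (congrFun (eq_zero_of_det_ne_zero (g := fun j => MvPolynomial.eval x (pderiv j G))
    hdet ?_ hb hc) i)
  have : ∑ j, x j * MvPolynomial.eval x (pderiv j G)
      = ∑ j, a j * MvPolynomial.eval x (pderiv j G)
        + s * ∑ j, b j * MvPolynomial.eval x (pderiv j G)
        + t * ∑ j, c j * MvPolynomial.eval x (pderiv j G) := by
    simp only [Finset.mul_sum, ← Finset.sum_add_distrib, hx]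
    refine Finset.sum_congr rfl fun j _ => by ring
  rw [heuler, hb, hc] at this
  linear_combination -this

lemma eval_linePoly_swap {ι : Type*} {k : ℕ} {Q : MvPolynomial ι ℂ} (hQ : Q.IsHomogeneous k)
    (a b : ι → ℂ) {s : ℂ} (hs : s ≠ 0) :
    (linePoly Q b a).eval s = s ^ k * (linePoly Q a b).eval s⁻¹ := by
  rw [eval_linePoly, eval_linePoly, ← eval_homogeneous_smul hQ]
  congr 2
  ext i
  field_simp
  ring

lemma infinite_setOf_ne_zero : {s : ℂ | s ≠ 0}.Infinite := by
  have := Set.Finite.infinite_compl (Set.finite_singleton (0 : ℂ))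
  exact this

lemma linePoly_swap_eq_zero {ι : Type*} {k : ℕ} {Q : MvPolynomial ι ℂ} (hQ : Q.IsHomogeneous k)
    {a b : ι → ℂ} (h : linePoly Q a b = 0) : linePoly Q b a = 0 := by
  refine eq_of_infinite_eval_eq _ _ (infinite_setOf_ne_zero.mono fun s hs => ?_)
  simp [eval_linePoly_swap hQ a b hs, h]

lemma exists_zero_on_line {ι : Type*} {k : ℕ} (hk : k ≠ 0) {Q : MvPolynomial ι ℂ}
    (hQ : Q.IsHomogeneous k) (a b : ι → ℂ) :
    (∃ t, (linePoly Q a b).eval t = 0) ∨ (linePoly Q b a).eval 0 = 0 := by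
  by_cases hdeg : (linePoly Q a b).degree = 0
  · right
    obtain ⟨κ, hκ⟩ : ∃ κ, linePoly Q a b = C κ := ⟨_, eq_C_of_degree_eq_zero hdeg⟩
    have : linePoly Q b a = C κ * X ^ k := by
      refine eq_of_infinite_eval_eq _ _ (infinite_setOf_ne_zero.mono fun s hs => ?_)
      rw [Set.mem_ofPred_eq, eval_linePoly_swap hQ a b hs, hκ, eval_C, eval_mul, eval_C, eval_pow,
        eval_X, mul_comm]
    simp [this, hk]
  · exact Or.inl (IsAlgClosed.exists_root _ hdeg)

lemma linePoly_ne_zero (hd : 2 ≤ d) (hG : G.IsHomogeneous d)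
    (hns : ∀ x : Fin 3 → ℂ, x ≠ 0 → ∃ i, MvPolynomial.eval x (pderiv i G) ≠ 0)
    {a b c : Fin 3 → ℂ} (hdet : (Matrix.of ![a, b, c]).det ≠ 0) : linePoly G a b ≠ 0 := by
  have key : ∀ a b : Fin 3 → ℂ, (Matrix.of ![a, b, c]).det ≠ 0 → linePoly G a b = 0 → ∀ t,
      (linePoly (∑ j, MvPolynomial.C (c j) * pderiv j G) a b).eval t = 0 → False := by
    intro a b hdet h t ht
    have h0 : (linePoly G a b).eval t = 0 := by simp [h]
    have h1 : (derivative (linePoly G a b)).eval t = 0 := by simp [h]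
    rw [eval_linePoly] at h0 ht
    rw [derivative_linePoly] at h1
    simp only [eval_finsetSum, eval_mul, eval_C, eval_linePoly] at h1
    simp only [map_sum, map_mul, MvPolynomial.eval_C] at ht
    refine not_singular hG hns hdet t 0 ?_ ?_ ?_ <;> simpa
  intro h
  have hQ : (∑ j, MvPolynomial.C (c j) * pderiv j G).IsHomogeneous (d - 1) :=
    MvPolynomial.IsHomogeneous.sum _ _ _ fun j _ => hG.pderiv.C_mul _
  rcases exists_zero_on_line (by omega) hQ a b with ⟨t, ht⟩ | ht
  · exact key a b hdet h t ht
  · refine key b a ?_ (linePoly_swap_eq_zero hG h) 0 ht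
    rw [Matrix.det_fin_three] at hdet ⊢
    intro h
    apply hdet
    simp at h ⊢
    linear_combination -h

lemma squarefree_map_algebraMap {F : ℂ[X][X]} (hF : F ≠ 0)
    (h : ∀ s t, (F.map (evalRingHom s)).eval t = 0 →
      (derivative (F.map (evalRingHom s))).eval t = 0 →
      (derivative (F.eval (C t))).eval s = 0 → False) :
    Squarefree (F.map (algebraMap ℂ[X] (FractionRing ℂ[X]))) := by
  have hinj : Function.Injective (algebraMap ℂ[X] (FractionRing ℂ[X])) :=
    IsFractionRing.injective _ _
  have hinj' := Polynomial.map_injective _ hinj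
  rintro A ⟨B, hB⟩
  by_contra hA
  have hF' : F.map (algebraMap ℂ[X] (FractionRing ℂ[X])) ≠ 0 := by
    rwa [Ne, Polynomial.map_eq_zero_iff hinj]
  have hA0 : A ≠ 0 := by rintro rfl; simp_all
  have hAdeg : A.natDegree ≠ 0 := fun h0 => hA (by
    rw [Polynomial.isUnit_iff_degree_eq_zero]
    exact (Polynomial.degree_eq_iff_natDegree_eq hA0).2 h0)
  obtain ⟨b₁, hb₁M, hb₁⟩ :=
    IsLocalization.integerNormalization_spec (nonZeroDivisors ℂ[X]) A
  obtain ⟨b₂, hb₂M, hb₂⟩ :=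
    IsLocalization.integerNormalization_spec (nonZeroDivisors ℂ[X]) B
  set A₁ := IsLocalization.integerNormalization (nonZeroDivisors ℂ[X]) A
  set B₁ := IsLocalization.integerNormalization (nonZeroDivisors ℂ[X]) B
  have hb₁0 : b₁ ≠ 0 := nonZeroDivisors.ne_zero hb₁M
  have hb₂0 : b₂ ≠ 0 := nonZeroDivisors.ne_zero hb₂M
  set c : ℂ[X] := b₁ * b₁ * b₂ with hc
  have hc0 : c ≠ 0 := by positivity
  have hfac : C c * F = A₁ * A₁ * B₁ := by
    apply hinj'
    rw [Polynomial.map_mul, Polynomial.map_mul, Polynomial.map_mul, hb₁, hb₂, hB, Polynomial.map_C,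
      hc]
    simp only [Algebra.smul_def, map_mul]
    simp only [IsScalarTower.algebraMap_apply ℂ[X] (FractionRing ℂ[X]) (FractionRing ℂ[X])[X],
      Polynomial.algebraMap_eq]
    ring
  have hA₁deg : A₁.natDegree ≠ 0 := by
    rw [← Polynomial.natDegree_map_eq_of_injective hinj, hb₁, Algebra.smul_def,
      IsScalarTower.algebraMap_apply ℂ[X] (FractionRing ℂ[X]) (FractionRing ℂ[X])[X],
      Polynomial.algebraMap_eq, natDegree_C_mul (by simpa using hb₁0)]
    exact hAdeg
  have hA₁0 : A₁ ≠ 0 := by rintro h; simp [h] at hA₁deg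
  obtain ⟨s, hs⟩ : ∃ s, (c * A₁.leadingCoeff).eval s ≠ 0 := by
    by_contra! h
    exact mul_ne_zero hc0 (leadingCoeff_ne_zero.2 hA₁0) (Polynomial.funext fun s => by simpa using h s)
  rw [eval_mul] at hs
  have hdeg : (A₁.map (evalRingHom s)).natDegree = A₁.natDegree :=
    natDegree_map_of_leadingCoeff_ne_zero _ (right_ne_zero_of_mul hs)
  obtain ⟨t, ht⟩ := IsAlgClosed.exists_root (A₁.map (evalRingHom s)) (by
    intro h0
    exact hA₁deg (hdeg ▸ natDegree_eq_of_degree_eq_some h0))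
  have hcs : c.eval s ≠ 0 := left_ne_zero_of_mul hs
  have e1 := congrArg (Polynomial.map (evalRingHom s)) hfac
  have e2 := congrArg (Polynomial.eval (C t)) hfac
  simp only [Polynomial.map_mul, Polynomial.map_C, coe_evalRingHom, eval_mul, eval_C] at e1 e2
  have ht' : (A₁.eval (C t)).eval s = 0 := by
    rw [← ht.eq_zero, map_evalRingHom_eval, evalEval]
  have g0 := congrArg (Polynomial.eval t) e1
  have g1 := congrArg (fun p => (derivative p).eval t) e1
  have g2 := congrArg (fun p => (derivative p).eval s) e2
  rw [IsRoot.def] at ht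
  simp only [eval_mul, eval_C, derivative_mul, derivative_C, eval_add, ht, ht', zero_mul, mul_zero,
    zero_add, add_zero, mul_eq_zero, hcs, false_or] at g0 g1 g2
  have g0' : (F.eval (C t)).eval s = 0 := by
    rw [← g0, map_evalRingHom_eval, evalEval]
  rw [g0', mul_zero, zero_add, mul_eq_zero] at g2
  exact h s t g0 g1 (g2.resolve_left hcs)

lemma resultant_derivative_ne_zero {F : ℂ[X][X]} (hF : F ≠ 0)
    (h : ∀ s t, (F.map (evalRingHom s)).eval t = 0 →
      (derivative (F.map (evalRingHom s))).eval t = 0 →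
      (derivative (F.eval (C t))).eval s = 0 → False) :
    resultant F (derivative F) ≠ 0 := by
  have hinj : Function.Injective (algebraMap ℂ[X] (FractionRing ℂ[X])) :=
    IsFractionRing.injective _ _
  have hsep := PerfectField.separable_iff_squarefree.2 (squarefree_map_algebraMap hF h)
  intro h0
  have := resultant_map_map F (derivative F) F.natDegree (derivative F).natDegree
    (algebraMap ℂ[X] (FractionRing ℂ[X]))
  rw [h0, map_zero, ← Polynomial.natDegree_map_eq_of_injective hinj,
    ← Polynomial.natDegree_map_eq_of_injective hinj (derivative F), resultant_eq_zero_iff,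
    ← derivative_map] at this
  exact this.2 hsep

lemma natDegree_resultant_le {k : ℕ} {F₁ F₂ : ℂ[X][X]} (m n : ℕ)
    (h₁ : ∀ j, (F₁.coeff j).natDegree ≤ k) (h₂ : ∀ j, (F₂.coeff j).natDegree ≤ k) :
    (resultant F₁ F₂ m n).natDegree ≤ (m + n) * k := by
  rw [resultant, Matrix.det_apply]
  refine natDegree_sum_le_of_forall_le _ _ fun σ _ => ?_
  refine (natDegree_smul_le _ _).trans ((natDegree_prod_le _ _).trans ?_)
  refine (Finset.sum_le_card_nsmul _ _ k fun i _ => ?_).trans (by simp)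
  rw [sylvester, Matrix.of_apply]
  induction i using Fin.addCases with
  | left j => rw [Fin.addCases_left]; split_ifs <;> simp [h₂]
  | right j => rw [Fin.addCases_right]; split_ifs <;> simp [h₁]

lemma natDegree_coeff_mul_le {P Q : ℂ[X][X]} {k l : ℕ} (hP : ∀ j, (P.coeff j).natDegree ≤ k)
    (hQ : ∀ j, (Q.coeff j).natDegree ≤ l) (j : ℕ) : ((P * Q).coeff j).natDegree ≤ k + l := by
  rw [coeff_mul]
  exact natDegree_sum_le_of_forall_le _ _ fun i _ =>
    natDegree_mul_le.trans (add_le_add (hP _) (hQ _))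

lemma natDegree_coeff_one_le (j : ℕ) : ((1 : ℂ[X][X]).coeff j).natDegree ≤ 0 := by
  rw [coeff_one]; split_ifs <;> simp

lemma natDegree_coeff_pow_le {P : ℂ[X][X]} {k : ℕ} (hP : ∀ j, (P.coeff j).natDegree ≤ k) (n : ℕ) :
    ∀ j, ((P ^ n).coeff j).natDegree ≤ n * k := by
  induction n with
  | zero => simpa using natDegree_coeff_one_le
  | succ n ih =>
    intro j
    rw [pow_succ, Nat.succ_mul]
    exact natDegree_coeff_mul_le ih hP j

lemma natDegree_coeff_prod_le {ι : Type*} (s : Finset ι) {P : ι → ℂ[X][X]} {k : ι → ℕ}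
    (hP : ∀ i j, ((P i).coeff j).natDegree ≤ k i) :
    ∀ j, ((∏ i ∈ s, P i).coeff j).natDegree ≤ ∑ i ∈ s, k i := by
  classical
  induction s using Finset.induction_on with
  | empty => simpa using natDegree_coeff_one_le
  | insert i s hi ih =>
    intro j
    rw [Finset.prod_insert hi, Finset.sum_insert hi]
    exact natDegree_coeff_mul_le (hP i) ih j

lemma natDegree_coeff_linePoly_le {ι : Type*} {G : MvPolynomial ι ℂ} (hG : G.IsHomogeneous d)
    {p q : ι → ℂ[X]} (hp : ∀ i, (p i).natDegree ≤ 1) (hq : ∀ i, (q i).natDegree ≤ 1) (j : ℕ) :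
    ((linePoly (MvPolynomial.map C G) p q).coeff j).natDegree ≤ d := by
  rw [linePoly, MvPolynomial.aeval_def, MvPolynomial.eval₂_map, MvPolynomial.eval₂_eq,
    finsetSum_coeff]
  refine natDegree_sum_le_of_forall_le _ _ fun m hm => ?_
  rw [RingHom.comp_apply, Polynomial.algebraMap_eq, coeff_C_mul]
  refine (natDegree_C_mul_le _ _).trans ?_
  have h := hG (MvPolynomial.mem_support_iff.1 hm)
  rw [Finsupp.weight_apply, Finsupp.sum] at h
  simp only [Pi.one_apply, smul_eq_mul] at h
  rw [← h]
  refine natDegree_coeff_prod_le _ (fun i => natDegree_coeff_pow_le (fun l => ?_) _) j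
  rw [coeff_add, coeff_C, coeff_C_mul, coeff_X]
  refine natDegree_add_le_of_degree_le ?_ ?_
  · split_ifs <;> simp [hp]
  · split_ifs <;> simp [hq]

/-- The restriction of `G` to the affine plane through `a` spanned by `w` and `v`. -/
noncomputable def planePoly (G : MvPolynomial (Fin 3) ℂ) (a w v : Fin 3 → ℂ) : ℂ[X][X] :=
  linePoly (MvPolynomial.map C G) (fun i => C (a i) + C (w i) * X) (fun i => C (v i))

lemma map_planePoly (G : MvPolynomial (Fin 3) ℂ) (a w v : Fin 3 → ℂ) (s : ℂ) :
    (planePoly G a w v).map (evalRingHom s) = linePoly G (fun i => a i + s * w i) v := by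
  have : (evalRingHom s).comp C = RingHom.id ℂ := by ext; simp
  rw [planePoly, map_linePoly, MvPolynomial.map_map, this, MvPolynomial.map_id]
  simp only [coe_evalRingHom, eval_add, eval_mul, eval_C, eval_X, mul_comm s]

lemma eval_planePoly (G : MvPolynomial (Fin 3) ℂ) (a w v : Fin 3 → ℂ) (t : ℂ) :
    (planePoly G a w v).eval (C t) = linePoly G (fun i => a i + t * v i) w := by
  rw [planePoly, eval_linePoly, linePoly, MvPolynomial.aeval_def, MvPolynomial.eval_map,
    Polynomial.algebraMap_eq]
  congr 1
  ext1 i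
  simp only [map_add, map_mul]
  ring

lemma exists_tangency_poly (hd : 2 ≤ d) (hG : G.IsHomogeneous d)
    (hns : ∀ x : Fin 3 → ℂ, x ≠ 0 → ∃ i, MvPolynomial.eval x (pderiv i G) ≠ 0)
    {a w v : Fin 3 → ℂ} (hdet : (Matrix.of ![a, w, v]).det ≠ 0) :
    ∃ D : ℂ[X], D ≠ 0 ∧ D.natDegree ≤ 2 * d * d ∧ ∀ s t : ℂ,
      MvPolynomial.eval (fun i => a i + s * w i + t * v i) G = 0 →
      ∑ j, v j * MvPolynomial.eval (fun i => a i + s * w i + t * v i) (pderiv j G) = 0 →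
      D.eval s = 0 := by
  set P := planePoly G a w v with hP
  have hmap : ∀ s t, (P.map (evalRingHom s)).eval t
      = MvPolynomial.eval (fun i => a i + s * w i + t * v i) G := fun s t => by
    rw [hP, map_planePoly, eval_linePoly]
  have hdt : ∀ s t, (derivative (P.map (evalRingHom s))).eval t
      = ∑ j, v j * MvPolynomial.eval (fun i => a i + s * w i + t * v i) (pderiv j G) := fun s t => by
    rw [hP, map_planePoly, derivative_linePoly, eval_finsetSum]
    simp only [eval_mul, eval_C, eval_linePoly]
  have hds : ∀ s t, (derivative (P.eval (C t))).eval s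
      = ∑ j, w j * MvPolynomial.eval (fun i => a i + s * w i + t * v i) (pderiv j G) := fun s t => by
    rw [hP, eval_planePoly, derivative_linePoly, eval_finsetSum]
    simp only [eval_mul, eval_C, eval_linePoly, add_right_comm]
  have hP0 : P ≠ 0 := by
    intro h0
    have hdet' : (Matrix.of ![a, v, w]).det ≠ 0 := by
      rw [Matrix.det_fin_three] at hdet ⊢
      intro h
      apply hdet
      simp at h ⊢
      linear_combination -h
    apply linePoly_ne_zero hd hG hns hdet'
    have := map_planePoly G a w v 0
    rw [← hP, h0] at this
    simpa using this.symm
  have hcoeff : ∀ j, (P.coeff j).natDegree ≤ d := by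
    refine natDegree_coeff_linePoly_le hG (fun i => ?_) (fun i => by simp)
    exact natDegree_add_le_of_degree_le (by simp) ((natDegree_C_mul_le _ _).trans natDegree_X_le)
  have hdeg : P.natDegree ≤ d := natDegree_linePoly_le (hG.map _) _ _
  by_cases h0 : P.natDegree = 0
  · obtain ⟨D, hD⟩ := natDegree_eq_zero.1 h0
    refine ⟨D, fun h => hP0 (by rw [← hD, h, C_0]), ?_, fun s t h _ => ?_⟩
    · have := hcoeff 0
      rw [← hD, coeff_C_zero] at this
      nlinarith
    · rw [← hmap, ← hD, Polynomial.map_C, eval_C] at h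
      exact h
  · refine ⟨resultant P (derivative P), resultant_derivative_ne_zero hP0 fun s t h₁ h₂ h₃ => ?_, ?_,
      fun s t h₁ h₂ => ?_⟩
    · exact not_singular hG hns hdet s t (hmap s t ▸ h₁) (hds s t ▸ h₃) (hdt s t ▸ h₂)
    · refine (natDegree_resultant_le (k := d) _ _ hcoeff fun j => ?_).trans
        (Nat.mul_le_mul_right _ ?_)
      · rw [coeff_derivative]
        refine natDegree_mul_le.trans ?_
        rw [show ((j : ℂ[X]) + 1) = ((j + 1 : ℕ) : ℂ[X]) by push_cast; rfl, natDegree_natCast]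
        exact hcoeff _
      · have := natDegree_derivative_le P
        omega
    · obtain ⟨p, q, -, -, hpq⟩ :=
        exists_mul_add_mul_eq_C_resultant P (derivative P) le_rfl le_rfl (Or.inl h0)
      have := congrArg (fun F => (F.map (evalRingHom s)).eval t) hpq
      simp only [Polynomial.map_add, Polynomial.map_mul, eval_add, eval_mul, Polynomial.map_C,
        eval_C, coe_evalRingHom, ← derivative_map, hmap, hdt, h₁, h₂, zero_mul, add_zero] at this
      exact this.symm

end Complex

lemma eval_map_ofReal {ι : Type*} (F : MvPolynomial ι ℝ) (x : ι → ℝ) :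
    MvPolynomial.eval (fun i => (x i : ℂ)) (MvPolynomial.map Complex.ofRealHom F)
      = (MvPolynomial.eval x F : ℂ) := by
  have := MvPolynomial.eval₂_comp_left Complex.ofRealHom (RingHom.id ℝ) x F
  rw [MvPolynomial.eval_map]
  exact this.symm

lemma det_ofReal_ne_zero {a b c : Fin 3 → ℝ} (hdet : (Matrix.of ![a, b, c]).det ≠ 0) :
    (Matrix.of ![fun i => (a i : ℂ), fun i => (b i : ℂ), fun i => (c i : ℂ)]).det ≠ 0 := by
  rw [Matrix.det_fin_three] at hdet ⊢
  simp at hdet ⊢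
  exact_mod_cast hdet

section Real

variable {d : ℕ} {F : MvPolynomial (Fin 3) ℝ}

lemma linePoly_ne_zero_real (hd : 2 ≤ d) (hF : F.IsHomogeneous d)
    (hns : ∀ x : Fin 3 → ℂ, x ≠ 0 →
      ∃ i, MvPolynomial.eval x (pderiv i (MvPolynomial.map Complex.ofRealHom F)) ≠ 0)
    {a b c : Fin 3 → ℝ} (hdet : (Matrix.of ![a, b, c]).det ≠ 0) : linePoly F a b ≠ 0 := by
  intro h
  apply linePoly_ne_zero hd (hF.map Complex.ofRealHom) hns (det_ofReal_ne_zero hdet)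
  have := map_linePoly Complex.ofRealHom F a b
  rw [h, Polynomial.map_zero] at this
  exact this.symm

lemma exists_finset_tangency (hd : 2 ≤ d) (hF : F.IsHomogeneous d)
    (hns : ∀ x : Fin 3 → ℂ, x ≠ 0 →
      ∃ i, MvPolynomial.eval x (pderiv i (MvPolynomial.map Complex.ofRealHom F)) ≠ 0)
    {a w v : Fin 3 → ℝ} (hdet : (Matrix.of ![a, w, v]).det ≠ 0) :
    ∃ Z : Finset ℝ, Z.card ≤ 2 * d * d ∧ ∀ s t : ℝ,
      MvPolynomial.eval (fun i => a i + s * w i + t * v i) F = 0 →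
      ∑ j, v j * MvPolynomial.eval (fun i => a i + s * w i + t * v i) (pderiv j F) = 0 →
      s ∈ Z := by
  obtain ⟨D, hD0, hDd, hD⟩ := exists_tangency_poly hd (hF.map Complex.ofRealHom) hns
    (det_ofReal_ne_zero hdet)
  refine ⟨D.roots.toFinset.image Complex.re, ?_, fun s t h₁ h₂ => ?_⟩
  · exact Finset.card_image_le.trans ((Multiset.toFinset_card_le _).trans ((card_roots' D).trans hDd))
  · refine Finset.mem_image.2 ⟨(s : ℂ), ?_, Complex.ofReal_re s⟩
    rw [Multiset.mem_toFinset, mem_roots hD0, IsRoot.def]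
    have hx : (fun i => (a i : ℂ) + s * w i + t * v i)
        = fun i => ((a i + s * w i + t * v i : ℝ) : ℂ) := by ext; push_cast; rfl
    refine hD s t ?_ ?_
    · rw [hx, eval_map_ofReal, h₁, Complex.ofReal_zero]
    · simp only [hx, MvPolynomial.pderiv_map, eval_map_ofReal]
      exact_mod_cast h₂

/-- The affine parametrization of the plane through `U₀` spanned by `U₁` and `U₂`. -/
def chart (U₀ U₁ U₂ : Fin 3 → ℝ) (p : ℝ × ℝ) (i : Fin 3) : ℝ := U₀ i + p.1 * U₁ i + p.2 * U₂ i

lemma hasStrictFDerivAt_eval_chart (U₀ U₁ U₂ : Fin 3 → ℝ) (F : MvPolynomial (Fin 3) ℝ) (p : ℝ × ℝ) :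
    HasStrictFDerivAt (fun p => MvPolynomial.eval (chart U₀ U₁ U₂ p) F)
      ((∑ j, U₁ j * MvPolynomial.eval (chart U₀ U₁ U₂ p) (pderiv j F)) • ContinuousLinearMap.fst ℝ ℝ ℝ
        + (∑ j, U₂ j * MvPolynomial.eval (chart U₀ U₁ U₂ p) (pderiv j F)) •
          ContinuousLinearMap.snd ℝ ℝ ℝ) p := by
  induction F using MvPolynomial.induction_on with
  | C a =>
    simpa using hasStrictFDerivAt_const a p
  | add f g hf hg =>
    simp only [map_add]
    refine (hf.add hg).congr_fderiv ?_
    simp only [mul_add, Finset.sum_add_distrib, add_smul]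
    abel
  | mul_X f i hf =>
    have hx : HasStrictFDerivAt (fun p => chart U₀ U₁ U₂ p i)
        (U₁ i • ContinuousLinearMap.fst ℝ ℝ ℝ + U₂ i • ContinuousLinearMap.snd ℝ ℝ ℝ) p := by
      have h1 := (hasStrictFDerivAt_fst (𝕜 := ℝ) (p := p)).mul_const (U₁ i)
      have h2 := (hasStrictFDerivAt_snd (𝕜 := ℝ) (p := p)).mul_const (U₂ i)
      simpa [chart, add_assoc] using (h1.add h2).const_add (U₀ i)
    have hpd : ∀ j, MvPolynomial.eval (chart U₀ U₁ U₂ p) (pderiv j (f * MvPolynomial.X i))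
        = MvPolynomial.eval (chart U₀ U₁ U₂ p) (pderiv j f) * chart U₀ U₁ U₂ p i
          + if i = j then MvPolynomial.eval (chart U₀ U₁ U₂ p) f else 0 := by
      intro j
      rw [Derivation.leibniz, MvPolynomial.pderiv_X]
      by_cases h : i = j
      · subst h
        simp
        ring
      · simp [h]
        ring
    have := hf.mul hx
    simp only [map_mul, MvPolynomial.eval_X]
    refine this.congr_fderiv ?_
    simp only [hpd, mul_add, Finset.sum_add_distrib, mul_ite, mul_zero, Finset.sum_ite_eq,
      Finset.mem_univ, if_true, ← mul_assoc, ← Finset.sum_mul]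
    ext <;> simp <;> ring

lemma continuous_eval_chart (U₀ U₁ U₂ : Fin 3 → ℝ) (F : MvPolynomial (Fin 3) ℝ) :
    Continuous fun p => MvPolynomial.eval (chart U₀ U₁ U₂ p) F :=
  continuous_iff_continuousAt.2 fun p => (hasStrictFDerivAt_eval_chart U₀ U₁ U₂ F p).continuousAt

/-- The constant in `card_le_of_shallow` for plane curves of degree `d`. -/
def shallowConst (d : ℕ) : ℕ := (3 + 2 * d + 4 * (2 * d * d * d)) * (d + 2 * (d * d))

lemma card_le_of_chart_shallow (hd : 2 ≤ d) (hF : F.IsHomogeneous d)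
    (hns : ∀ x : Fin 3 → ℂ, x ≠ 0 →
      ∃ i, MvPolynomial.eval x (pderiv i (MvPolynomial.map Complex.ofRealHom F)) ≠ 0)
    {U₀ U₁ U₂ : Fin 3 → ℝ} (hdet : (Matrix.of ![U₀, U₁, U₂]).det ≠ 0) {N : ℕ} (hN : 1 ≤ N)
    (S : Finset (ℝ × ℝ)) (hS : ∀ p ∈ S, |p.1| ≤ 1 ∧ |p.2| ≤ 1 ∧
      MvPolynomial.eval (chart U₀ U₁ U₂ p) F = 0 ∧
      |∑ j, U₁ j * MvPolynomial.eval (chart U₀ U₁ U₂ p) (pderiv j F)|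
        ≤ |∑ j, U₂ j * MvPolynomial.eval (chart U₀ U₁ U₂ p) (pderiv j F)|)
    (harea : ∀ p ∈ S, ∀ q ∈ S, ∀ r ∈ S, area p q r = 0 ∨ 1 / (N : ℝ) ^ 3 ≤ |area p q r|) :
    S.card ≤ shallowConst d * N := by
  have hdd : 2 * d * d ≤ 2 * d * d * d := Nat.le_mul_of_pos_right _ (by omega)
  have hdet₂ : ∀ x y a b : ℝ, a ≠ 0 → (Matrix.of ![fun i => U₀ i + x * U₁ i + y * U₂ i,
      fun i => a * U₁ i + b * U₂ i, U₂]).det ≠ 0 := by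
    intro x y a b ha h
    apply mul_ne_zero ha hdet
    rw [Matrix.det_fin_three] at h ⊢
    simp [-mul_eq_zero] at h ⊢
    linear_combination h
  have hdet₁ : ∀ x y b : ℝ, b ≠ 0 → (Matrix.of ![fun i => U₀ i + x * U₁ i + y * U₂ i,
      fun i => 0 * U₁ i + b * U₂ i, U₁]).det ≠ 0 := by
    intro x y b hb h
    apply mul_ne_zero hb hdet
    rw [Matrix.det_fin_three] at h ⊢
    simp [-mul_eq_zero] at h ⊢
    linear_combination -h
  refine card_le_of_shallow (f := fun p => MvPolynomial.eval (chart U₀ U₁ U₂ p) F)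
    (by omega) hN (hasStrictFDerivAt_eval_chart U₀ U₁ U₂ F)
    (continuous_finsetSum _ fun j _ => (continuous_eval_chart _ _ _ _).const_mul _)
    (continuous_finsetSum _ fun j _ => (continuous_eval_chart _ _ _ _).const_mul _)
    ?_ ?_ ?_ S hS harea
  · intro p v hv
    have hne : linePoly F (chart U₀ U₁ U₂ p) (fun i => v.1 * U₁ i + v.2 * U₂ i) ≠ 0 := by
      by_cases hv1 : v.1 = 0
      · rw [hv1]
        exact linePoly_ne_zero_real hd hF hns
          (hdet₁ p.1 p.2 v.2 fun h => hv (Prod.ext hv1 h))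
      · exact linePoly_ne_zero_real hd hF hns (hdet₂ p.1 p.2 v.1 v.2 hv1)
    refine ⟨(linePoly F (chart U₀ U₁ U₂ p) (fun i => v.1 * U₁ i + v.2 * U₂ i)).roots.toFinset,
      (Multiset.toFinset_card_le _).trans ((card_roots' _).trans (natDegree_linePoly_le hF _ _)),
      fun τ h => ?_⟩
    rw [Multiset.mem_toFinset, mem_roots hne, IsRoot.def, eval_linePoly, ← h]
    congr 2
    ext i
    simp only [chart, Prod.fst_add, Prod.snd_add, Prod.smul_fst, Prod.smul_snd, smul_eq_mul]
    ring
  · obtain ⟨Z, hZ, h⟩ := exists_finset_tangency hd hF hns hdet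
    exact ⟨Z, hZ.trans hdd, fun p h₁ h₂ => h p.1 p.2 h₁ h₂⟩
  · intro m
    have hdet₃ : (Matrix.of ![U₀, U₂, fun i => U₁ i + m * U₂ i]).det ≠ 0 := by
      intro h
      apply hdet
      rw [Matrix.det_fin_three] at h ⊢
      simp at h ⊢
      linear_combination -h
    obtain ⟨Z, hZ, h⟩ := exists_finset_tangency hd hF hns hdet₃
    have hne : ∀ σ : ℝ, linePoly F (fun i => U₀ i + σ * U₂ i) (fun i => U₁ i + m * U₂ i) ≠ 0 := by
      intro σ
      have := hdet₂ 0 σ 1 m one_ne_zero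
      simp only [zero_mul, add_zero, one_mul] at this
      exact linePoly_ne_zero_real hd hF hns this
    refine ⟨Z.biUnion fun σ =>
      (linePoly F (fun i => U₀ i + σ * U₂ i) (fun i => U₁ i + m * U₂ i)).roots.toFinset, ?_, ?_⟩
    · refine (Finset.card_biUnion_le_card_mul _ _ d fun σ _ => ?_).trans
        (Nat.mul_le_mul_right d hZ)
      exact (Multiset.toFinset_card_le _).trans ((card_roots' _).trans
        (natDegree_linePoly_le hF _ _))
    · intro p h₁ h₂
      have hx : (fun i => U₀ i + (p.2 - m * p.1) * U₂ i + p.1 * (U₁ i + m * U₂ i))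
          = chart U₀ U₁ U₂ p := by
        ext i
        simp only [chart]
        ring
      refine Finset.mem_biUnion.2 ⟨p.2 - m * p.1, h _ p.1 ?_ ?_, ?_⟩
      · rw [hx, h₁]
      · rw [hx, ← h₂, Finset.mul_sum, ← Finset.sum_add_distrib]
        exact Finset.sum_congr rfl fun j _ => by ring
      · rw [Multiset.mem_toFinset, mem_roots (hne _), IsRoot.def, eval_linePoly, hx, h₁]

lemma card_le_of_chart (hd : 2 ≤ d) (hF : F.IsHomogeneous d)
    (hns : ∀ x : Fin 3 → ℂ, x ≠ 0 →
      ∃ i, MvPolynomial.eval x (pderiv i (MvPolynomial.map Complex.ofRealHom F)) ≠ 0)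
    {U₀ U₁ U₂ : Fin 3 → ℝ} (hdet : (Matrix.of ![U₀, U₁, U₂]).det ≠ 0) {N : ℕ} (hN : 1 ≤ N)
    (S : Finset (ℝ × ℝ)) (hS : ∀ p ∈ S, |p.1| ≤ 1 ∧ |p.2| ≤ 1 ∧
      MvPolynomial.eval (chart U₀ U₁ U₂ p) F = 0)
    (harea : ∀ p ∈ S, ∀ q ∈ S, ∀ r ∈ S, area p q r = 0 ∨ 1 / (N : ℝ) ^ 3 ≤ |area p q r|) :
    S.card ≤ 2 * shallowConst d * N := by
  classical
  have hswap : ∀ p : ℝ × ℝ, chart U₀ U₂ U₁ p.swap = chart U₀ U₁ U₂ p := fun p => by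
    ext i
    simp only [chart, Prod.fst_swap, Prod.snd_swap]
    ring
  have hdet' : (Matrix.of ![U₀, U₂, U₁]).det ≠ 0 := by
    intro h
    apply hdet
    rw [Matrix.det_fin_three] at h ⊢
    simp at h ⊢
    linear_combination -h
  rw [← Finset.card_filter_add_card_filter_not (s := S)
    (fun p => |∑ j, U₁ j * MvPolynomial.eval (chart U₀ U₁ U₂ p) (pderiv j F)|
        ≤ |∑ j, U₂ j * MvPolynomial.eval (chart U₀ U₁ U₂ p) (pderiv j F)|), mul_assoc, two_mul]
  refine add_le_add ?_ ?_
  · refine card_le_of_chart_shallow hd hF hns hdet hN _ (fun p hp => ?_) fun p hp q hq r hr =>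
      harea p (Finset.mem_filter.1 hp).1 q (Finset.mem_filter.1 hq).1 r (Finset.mem_filter.1 hr).1
    obtain ⟨hp, hle⟩ := Finset.mem_filter.1 hp
    exact ⟨(hS p hp).1, (hS p hp).2.1, (hS p hp).2.2, hle⟩
  · rw [← Finset.card_image_of_injective _ Prod.swap_injective]
    refine card_le_of_chart_shallow hd hF hns hdet' hN _ ?_ ?_
    · simp only [Finset.forall_mem_image]
      intro p hp
      obtain ⟨hp, hle⟩ := Finset.mem_filter.1 hp
      rw [hswap]
      exact ⟨(hS p hp).2.1, (hS p hp).1, (hS p hp).2.2, (not_le.1 hle).le⟩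
    · simp only [Finset.forall_mem_image]
      intro p hp q hq r hr
      have := harea p (Finset.mem_filter.1 hp).1 q (Finset.mem_filter.1 hq).1
        r (Finset.mem_filter.1 hr).1
      rwa [show area p.swap q.swap r.swap = -area p q r by
        simp only [area, Prod.fst_swap, Prod.snd_swap]; ring, neg_eq_zero, abs_neg]

end Real

lemma eq_or_eq_neg_of_primitive {x y : Fin 3 → ℤ}
    (hx : Int.gcd (x 0) (Int.gcd (x 1) (x 2)) = 1) (hy : Int.gcd (y 0) (Int.gcd (y 1) (y 2)) = 1)
    (h : ∀ i j, x i * y j = x j * y i) : y = x ∨ y = -x := by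
  obtain ⟨a, b, hab⟩ := Int.isCoprime_iff_gcd_eq_one.2 hx
  rw [Int.gcd_eq_gcd_ab (x 1) (x 2)] at hab
  set u := Int.gcdA (x 1) (x 2)
  set v := Int.gcdB (x 1) (x 2)
  set k := a * y 0 + b * (u * y 1 + v * y 2) with hk
  have hyk : ∀ j, y j = k * x j := fun j => by
    rw [hk]
    linear_combination (-y j) * hab + a * h 0 j + b * u * h 1 j + b * v * h 2 j
  have hk1 : k ∣ 1 := by
    have h1 : ∀ j, k ∣ y j := fun j => ⟨x j, hyk j⟩
    have := Int.dvd_coe_gcd (h1 0) (Int.dvd_coe_gcd (h1 1) (h1 2))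
    rwa [hy] at this
  rcases Int.isUnit_iff.1 (isUnit_of_dvd_one hk1) with h1 | h1
  · left; ext j; rw [hyk, h1, one_mul]
  · right; ext j; rw [hyk, h1, Pi.neg_apply, neg_one_mul]

lemma det_chart (U₀ U₁ U₂ : Fin 3 → ℝ) (p q r : ℝ × ℝ) :
    (Matrix.of ![chart U₀ U₁ U₂ p, chart U₀ U₁ U₂ q, chart U₀ U₁ U₂ r]).det
      = area p q r * (Matrix.of ![U₀, U₁, U₂]).det := by
  rw [Matrix.det_fin_three, Matrix.det_fin_three]
  simp [chart, area]
  ring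

lemma eval_intCast {ι R : Type*} [CommRing R] (H : MvPolynomial ι ℤ) (x : ι → ℤ) :
    MvPolynomial.eval (fun i => (x i : R)) (MvPolynomial.map (Int.castRingHom R) H)
      = (MvPolynomial.eval x H : R) := by
  have := MvPolynomial.eval₂_comp_left (Int.castRingHom R) (RingHom.id ℤ) x H
  rw [MvPolynomial.eval_map]
  exact this.symm

variable {d : ℕ} {H : MvPolynomial (Fin 3) ℤ}

lemma card_le_of_face (hd : 2 ≤ d) (hH : H.IsHomogeneous d)
    (hns : ∀ x : Fin 3 → ℂ, x ≠ 0 → ∃ i, MvPolynomial.aeval x (pderiv i H) ≠ 0)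
    {U₀ U₁ U₂ : Fin 3 → ℝ} (hdet : (Matrix.of ![U₀, U₁, U₂]).det ≠ 0) {N : ℕ} (hN : 1 ≤ N)
    (hdetN : |(Matrix.of ![U₀, U₁, U₂]).det| ≤ (N : ℝ) ^ 3) (T : Finset (Fin 3 → ℤ))
    (hT : ∀ x ∈ T, Int.gcd (x 0) (Int.gcd (x 1) (x 2)) = 1 ∧ MvPolynomial.eval x H = 0 ∧
      ∃ (r : ℝ) (p : ℝ × ℝ), |r| ≤ 1 ∧ |p.1| ≤ 1 ∧ |p.2| ≤ 1 ∧
        ∀ i, (x i : ℝ) = r * chart U₀ U₁ U₂ p i) :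
    T.card ≤ 4 * shallowConst d * N := by
  classical
  choose! hprim hzero r p hr hp₁ hp₂ hx using hT
  have hr0 : ∀ x ∈ T, r x ≠ 0 := by
    intro x hxT h
    have h0 : ∀ i, x i = 0 := fun i => by
      have := hx x hxT i
      rw [h, zero_mul] at this
      exact_mod_cast this
    have := hprim x hxT
    simp [h0] at this
  have hfib : T.card ≤ 2 * (T.image p).card := by
    refine Finset.card_le_mul_card_image T 2 fun a _ => ?_
    obtain h | ⟨x, hxf⟩ := (T.filter (p · = a)).eq_empty_or_nonempty
    · simp [h]
    obtain ⟨hxT, hxa⟩ := Finset.mem_filter.1 hxf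
    refine (Finset.card_le_card (t := {x, -x}) fun y hyf => ?_).trans Finset.card_le_two
    obtain ⟨hyT, hya⟩ := Finset.mem_filter.1 hyf
    simp only [Finset.mem_insert, Finset.mem_singleton]
    refine eq_or_eq_neg_of_primitive (hprim x hxT) (hprim y hyT) fun i j => ?_
    have : (x i * y j : ℝ) = x j * y i := by
      rw [hx x hxT i, hx x hxT j, hx y hyT i, hx y hyT j, hxa, hya]
      ring
    exact_mod_cast this
  have hF : (MvPolynomial.map (Int.castRingHom ℝ) H).IsHomogeneous d := hH.map _
  have hnsF : ∀ x : Fin 3 → ℂ, x ≠ 0 → ∃ i, MvPolynomial.eval x (pderiv i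
      (MvPolynomial.map Complex.ofRealHom (MvPolynomial.map (Int.castRingHom ℝ) H))) ≠ 0 := by
    intro x hx0
    obtain ⟨i, hi⟩ := hns x hx0
    refine ⟨i, ?_⟩
    rwa [MvPolynomial.map_map, MvPolynomial.pderiv_map, MvPolynomial.eval_map,
      RingHom.ext_int (Complex.ofRealHom.comp (Int.castRingHom ℝ)) (algebraMap ℤ ℂ),
      ← MvPolynomial.aeval_def]
  have hS := card_le_of_chart hd hF hnsF hdet hN (T.image p) ?_ ?_
  · calc T.card ≤ 2 * (T.image p).card := hfib
      _ ≤ 2 * (2 * shallowConst d * N) := by gcongr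
      _ = _ := by ring
  · simp only [Finset.forall_mem_image]
    intro x hxT
    refine ⟨hp₁ x hxT, hp₂ x hxT, ?_⟩
    have h := eval_homogeneous_smul hF (r x) (chart U₀ U₁ U₂ (p x))
    rw [← funext (hx x hxT), eval_intCast, hzero x hxT, Int.cast_zero] at h
    exact (mul_eq_zero.1 h.symm).resolve_left (pow_ne_zero _ (hr0 x hxT))
  · simp only [Finset.forall_mem_image]
    intro x hxT y hyT z hzT
    have hD : ((Matrix.of ![x, y, z]).det : ℝ)
        = r x * r y * r z * (area (p x) (p y) (p z) * (Matrix.of ![U₀, U₁, U₂]).det) := by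
      rw [← det_chart, Matrix.det_fin_three, Matrix.det_fin_three]
      simp [hx x hxT, hx y hyT, hx z hzT]
      ring
    by_cases h0 : (Matrix.of ![x, y, z]).det = 0
    · left
      rw [h0, Int.cast_zero] at hD
      simpa [hr0 x hxT, hr0 y hyT, hr0 z hzT, hdet] using hD
    · right
      have h1 : (1 : ℝ) ≤ |((Matrix.of ![x, y, z]).det : ℝ)| := by
        exact_mod_cast Int.one_le_abs h0
      rw [hD, abs_mul, abs_mul, abs_mul, abs_mul] at h1
      have h2 : |r x| * |r y| * |r z| ≤ 1 :=
        mul_le_one₀ (mul_le_one₀ (hr x hxT) (abs_nonneg _) (hr y hyT)) (abs_nonneg _) (hr z hzT)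
      rw [div_le_iff₀ (by positivity)]
      calc (1 : ℝ) ≤ |r x| * |r y| * |r z| * (|area (p x) (p y) (p z)| *
            |(Matrix.of ![U₀, U₁, U₂]).det|) := h1
        _ ≤ 1 * (|area (p x) (p y) (p z)| * (N : ℝ) ^ 3) := by gcongr
        _ = _ := one_mul _

lemma exists_chart_eq {U₀ U₁ U₂ : Fin 3 → ℝ} {x : Fin 3 → ℤ} {a b c : ℝ} (ha : |a| ≤ 1)
    (hb : |b| ≤ |a|) (hc : |c| ≤ |a|) (hx : ∀ i, (x i : ℝ) = a * U₀ i + b * U₁ i + c * U₂ i) :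
    ∃ (r : ℝ) (p : ℝ × ℝ), |r| ≤ 1 ∧ |p.1| ≤ 1 ∧ |p.2| ≤ 1 ∧
      ∀ i, (x i : ℝ) = r * chart U₀ U₁ U₂ p i := by
  refine ⟨a, (b / a, c / a), ha, ?_, ?_, fun i => ?_⟩
  · rw [abs_div]
    exact div_le_one_of_le₀ hb (abs_nonneg _)
  · rw [abs_div]
    exact div_le_one_of_le₀ hc (abs_nonneg _)
  · rw [hx, chart]
    rcases eq_or_ne a 0 with rfl | h
    · rw [abs_zero, abs_nonpos_iff] at hb hc
      simp [hb, hc]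
    · field_simp

lemma card_le_of_parallelepiped (hd : 2 ≤ d) (hH : H.IsHomogeneous d)
    (hns : ∀ x : Fin 3 → ℂ, x ≠ 0 → ∃ i, MvPolynomial.aeval x (pderiv i H) ≠ 0)
    {U₀ U₁ U₂ : Fin 3 → ℝ} (hdet : (Matrix.of ![U₀, U₁, U₂]).det ≠ 0) {N : ℕ} (hN : 1 ≤ N)
    (hdetN : |(Matrix.of ![U₀, U₁, U₂]).det| ≤ (N : ℝ) ^ 3) (T : Finset (Fin 3 → ℤ))
    (hT : ∀ x ∈ T, Int.gcd (x 0) (Int.gcd (x 1) (x 2)) = 1 ∧ MvPolynomial.eval x H = 0 ∧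
      ∃ a b c : ℝ, |a| ≤ 1 ∧ |b| ≤ 1 ∧ |c| ≤ 1 ∧
        ∀ i, (x i : ℝ) = a * U₀ i + b * U₁ i + c * U₂ i) :
    T.card ≤ 12 * shallowConst d * N := by
  classical
  have hdet₁ : (Matrix.of ![U₁, U₀, U₂]).det = -(Matrix.of ![U₀, U₁, U₂]).det := by
    rw [Matrix.det_fin_three, Matrix.det_fin_three]
    simp
    ring
  have hdet₂ : (Matrix.of ![U₂, U₀, U₁]).det = (Matrix.of ![U₀, U₁, U₂]).det := by
    rw [Matrix.det_fin_three, Matrix.det_fin_three]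
    simp
    ring
  have hface : ∀ V₀ V₁ V₂ : Fin 3 → ℝ, (Matrix.of ![V₀, V₁, V₂]).det ≠ 0 →
      |(Matrix.of ![V₀, V₁, V₂]).det| ≤ (N : ℝ) ^ 3 →
      (T.filter fun x => ∃ (r : ℝ) (p : ℝ × ℝ), |r| ≤ 1 ∧ |p.1| ≤ 1 ∧ |p.2| ≤ 1 ∧
        ∀ i, (x i : ℝ) = r * chart V₀ V₁ V₂ p i).card ≤ 4 * shallowConst d * N := by
    intro V₀ V₁ V₂ h₁ h₂
    refine card_le_of_face hd hH hns h₁ hN h₂ _ fun x hx => ?_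
    obtain ⟨hxT, h⟩ := Finset.mem_filter.1 hx
    exact ⟨(hT x hxT).1, (hT x hxT).2.1, h⟩
  have h₀ := hface U₀ U₁ U₂ hdet hdetN
  have h₁ := hface U₁ U₀ U₂ (by rwa [hdet₁, neg_ne_zero]) (by rwa [hdet₁, abs_neg])
  have h₂ := hface U₂ U₀ U₁ (by rwa [hdet₂]) (by rwa [hdet₂])
  set T₀ := T.filter fun x => ∃ (r : ℝ) (p : ℝ × ℝ), |r| ≤ 1 ∧ |p.1| ≤ 1 ∧ |p.2| ≤ 1 ∧
        ∀ i, (x i : ℝ) = r * chart U₀ U₁ U₂ p i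
  set T₁ := T.filter fun x => ∃ (r : ℝ) (p : ℝ × ℝ), |r| ≤ 1 ∧ |p.1| ≤ 1 ∧ |p.2| ≤ 1 ∧
        ∀ i, (x i : ℝ) = r * chart U₁ U₀ U₂ p i
  set T₂ := T.filter fun x => ∃ (r : ℝ) (p : ℝ × ℝ), |r| ≤ 1 ∧ |p.1| ≤ 1 ∧ |p.2| ≤ 1 ∧
        ∀ i, (x i : ℝ) = r * chart U₂ U₀ U₁ p i
  have hsub : T ⊆ T₀ ∪ T₁ ∪ T₂ := by
    intro x hxT
    obtain ⟨-, -, a, b, c, ha, hb, hc, hx⟩ := hT x hxT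
    simp only [T₀, T₁, T₂, Finset.mem_union, Finset.mem_filter, hxT, true_and]
    by_cases hba : |b| ≤ |a| ∧ |c| ≤ |a|
    · exact Or.inl (Or.inl (exists_chart_eq ha hba.1 hba.2 hx))
    by_cases hab : |a| ≤ |b| ∧ |c| ≤ |b|
    · exact Or.inl (Or.inr (exists_chart_eq hb hab.1 hab.2 fun i => by rw [hx]; ring))
    · have hac : |a| ≤ |c| ∧ |b| ≤ |c| := by grind
      exact Or.inr (exists_chart_eq hc hac.1 hac.2 fun i => by rw [hx]; ring)
  calc T.card ≤ (T₀ ∪ T₁ ∪ T₂).card := Finset.card_le_card hsub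
    _ ≤ T₀.card + T₁.card + T₂.card :=
        (Finset.card_union_le _ _).trans (add_le_add_left (Finset.card_union_le _ _) _)
    _ ≤ 4 * shallowConst d * N + 4 * shallowConst d * N + 4 * shallowConst d * N := by gcongr
    _ = _ := by ring

end PlaneCurve

open PlaneCurve in
theorem statement18 (d : ℕ) (hd : 2 ≤ d) :
    ∃ c : ℝ, 0 < c ∧
      ∀ H : MvPolynomial (Fin 3) ℤ, H.IsHomogeneous d →
        (∀ x : Fin 3 → ℂ, x ≠ 0 → ∃ i, MvPolynomial.aeval x (MvPolynomial.pderiv i H) ≠ 0) →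
        ∀ α ζ η B₁ B₂ B₃ : ℝ, 1 ≤ B₁ → 1 ≤ B₂ → 1 ≤ B₃ →
          (Set.ncard {x : Fin 3 → ℤ |
              Int.gcd (x 0) (Int.gcd (x 1) (x 2)) = 1 ∧
              MvPolynomial.eval x H = 0 ∧
              |(x 0 : ℝ) - α * (x 2 : ℝ)| ≤ B₁ ∧
              |(x 1 : ℝ) - ζ * (x 0 : ℝ) - η * (x 2 : ℝ)| ≤ B₂ ∧
              |(x 2 : ℝ)| ≤ B₃} : ℝ)
            ≤ c * (B₁ * B₂ * B₃) ^ ((1 : ℝ) / 3) := by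
  refine ⟨24 * shallowConst d + 1, by positivity, fun H hH hns α ζ η B₁ B₂ B₃ h₁ h₂ h₃ => ?_⟩
  set V := B₁ * B₂ * B₃ with hV
  have hV1 : 1 ≤ V := one_le_mul_of_one_le_of_one_le (one_le_mul_of_one_le_of_one_le h₁ h₂) h₃
  set w := V ^ ((1 : ℝ) / 3) with hw
  have hw1 : 1 ≤ w := Real.one_le_rpow hV1 (by norm_num)
  have hw3 : w ^ 3 = V := by
    rw [hw, ← Real.rpow_natCast, ← Real.rpow_mul (by positivity)]
    norm_num
  set N := ⌈w⌉₊
  have hwN : w ≤ N := Nat.le_ceil w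
  have hN2 : (N : ℝ) ≤ 2 * w := by linarith [Nat.ceil_lt_add_one (show 0 ≤ w by positivity)]
  have hN : 1 ≤ N := by exact_mod_cast hw1.trans hwN
  have hdet : (Matrix.of ![![B₁, B₁ * ζ, 0], ![0, B₂, 0],
      ![B₃ * α, B₃ * (ζ * α + η), B₃]]).det = V := by
    rw [Matrix.det_fin_three]
    simp [hV]
  by_cases hfin : {x : Fin 3 → ℤ |
              Int.gcd (x 0) (Int.gcd (x 1) (x 2)) = 1 ∧
              MvPolynomial.eval x H = 0 ∧
              |(x 0 : ℝ) - α * (x 2 : ℝ)| ≤ B₁ ∧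
              |(x 1 : ℝ) - ζ * (x 0 : ℝ) - η * (x 2 : ℝ)| ≤ B₂ ∧
              |(x 2 : ℝ)| ≤ B₃}.Finite
  · rw [Set.ncard_eq_toFinset_card _ hfin]
    have key := card_le_of_parallelepiped hd hH hns (by rw [hdet]; positivity) hN
      (by rw [hdet, abs_of_nonneg (by positivity), ← hw3]; gcongr) hfin.toFinset
      fun x hx => by
        obtain ⟨hp, hz, k₁, k₂, k₃⟩ := hfin.mem_toFinset.1 hx
        refine ⟨hp, hz, (x 0 - α * x 2) / B₁, (x 1 - ζ * x 0 - η * x 2) / B₂, x 2 / B₃, ?_, ?_, ?_,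
          fun i => ?_⟩
        · rw [abs_div, abs_of_pos (a := B₁) (by positivity)]
          exact div_le_one_of_le₀ k₁ (by positivity)
        · rw [abs_div, abs_of_pos (a := B₂) (by positivity)]
          exact div_le_one_of_le₀ k₂ (by positivity)
        · rw [abs_div, abs_of_pos (a := B₃) (by positivity)]
          exact div_le_one_of_le₀ k₃ (by positivity)
        · fin_cases i <;> simp <;> field_simp <;> ring
    calc (hfin.toFinset.card : ℝ) ≤ (12 * shallowConst d * N : ℕ) := by exact_mod_cast key
      _ = 12 * shallowConst d * N := by push_cast; rfl
      _ ≤ 12 * shallowConst d * (2 * w) := by gcongr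
      _ ≤ (24 * shallowConst d + 1) * w := by linarith
  · rw [Set.Infinite.ncard hfin, Nat.cast_zero]
    positivity
end

section
/- For every ε > 0 there is a constant C_ε with the following property: for every positive integer M, and all real numbers B, L with 1 ≤ L ≤ B and M ≤ B³, the number of triples (v, x₁, z₁) ∈ ℤ³ satisfying |v| ≤ M, 1 ≤ |z₁| ≤ B/L, v·z₁ ≠ 0 and |v·z₁ − M·x₁| ≤ B/L is at most C_ε·B^{2+ε}/L². -/
theorem exists_add_one_le_mul_rpow {δ : ℝ} (hδ : 0 < δ) :
    ∃ K : ℝ, 1 ≤ K ∧ ∀ (p : ℝ) (e : ℕ), 2 ≤ p → (e : ℝ) + 1 ≤ K * (p ^ e) ^ δ := by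
  have hl : 0 < Real.log 2 := Real.log_pos one_lt_two
  have hc : 0 < δ * Real.log 2 := mul_pos hδ hl
  refine ⟨1 + 1 / (δ * Real.log 2), by simp only [le_add_iff_nonneg_right]; positivity, ?_⟩
  intro p e hp
  have h2 : 1 + e * (δ * Real.log 2) ≤ (p ^ e) ^ δ := calc
    1 + e * (δ * Real.log 2) ≤ Real.exp (e * (δ * Real.log 2)) := by
      rw [add_comm]; exact Real.add_one_le_exp _
    _ = ((2 : ℝ) ^ e) ^ δ := by
      rw [Real.rpow_def_of_pos (by positivity), Real.log_pow]; ring_nf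
    _ ≤ (p ^ e) ^ δ := by gcongr
  calc (e : ℝ) + 1 ≤ (1 + 1 / (δ * Real.log 2)) * (1 + e * (δ * Real.log 2)) := by
        have : (1 + 1 / (δ * Real.log 2)) * (1 + e * (δ * Real.log 2))
            = e + 1 + (e * (δ * Real.log 2) + 1 / (δ * Real.log 2)) := by
          field_simp
          ring
        rw [this]
        have : 0 ≤ e * (δ * Real.log 2) + 1 / (δ * Real.log 2) := by positivity
        linarith
    _ ≤ _ := by gcongr

theorem add_one_le_rpow_of_two_le {δ p : ℝ} (hp : 0 ≤ p) (h : 2 ≤ p ^ δ) (e : ℕ) :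
    (e : ℝ) + 1 ≤ (p ^ e) ^ δ := by
  have h1 : (p ^ e) ^ δ = (p ^ δ) ^ e := by
    rw [← Real.rpow_natCast, ← Real.rpow_natCast, ← Real.rpow_mul hp, ← Real.rpow_mul hp,
      mul_comm]
  rw [h1]
  calc (e : ℝ) + 1 ≤ (2 : ℝ) ^ e := by exact_mod_cast Nat.lt_two_pow_self
    _ ≤ _ := by gcongr

/-- The divisor bound `d(n) = O(n ^ δ)`. -/
theorem exists_card_divisors_le_mul_rpow {δ : ℝ} (hδ : 0 < δ) :
    ∃ C : ℝ, 0 < C ∧ ∀ n : ℕ, n ≠ 0 → (n.divisors.card : ℝ) ≤ C * (n : ℝ) ^ δ := by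
  obtain ⟨K, hK1, hK⟩ := exists_add_one_le_mul_rpow hδ
  set P : ℕ := ⌈(2 : ℝ) ^ (1 / δ)⌉₊ with hP
  refine ⟨K ^ P, by positivity, fun n hn ↦ ?_⟩
  have hlarge : ∀ p : ℕ, P ≤ p → (2 : ℝ) ≤ (p : ℝ) ^ δ := fun p hp ↦ by
    have h := Nat.ceil_le.mp hp
    calc (2 : ℝ) = ((2 : ℝ) ^ (1 / δ)) ^ δ := by
          rw [← Real.rpow_mul (by norm_num), one_div_mul_cancel hδ.ne', Real.rpow_one]
      _ ≤ _ := by gcongr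
  calc (n.divisors.card : ℝ)
      = ∏ p ∈ n.primeFactors, ((n.factorization p : ℝ) + 1) := by
        rw [Nat.card_divisors hn]; push_cast; rfl
    _ ≤ ∏ p ∈ n.primeFactors,
          ((if p < P then K else 1) * ((p : ℝ) ^ n.factorization p) ^ δ) := by
        refine Finset.prod_le_prod (fun _ _ ↦ by positivity) fun p hp ↦ ?_
        split_ifs with h
        · exact hK p _ (by exact_mod_cast (Nat.prime_of_mem_primeFactors hp).two_le)
        · rw [one_mul]
          exact add_one_le_rpow_of_two_le p.cast_nonneg (hlarge p (not_lt.mp h)) _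
    _ = K ^ (n.primeFactors.filter (· < P)).card * (n : ℝ) ^ δ := by
        rw [Finset.prod_mul_distrib, Real.finsetProd_rpow _ _ fun _ _ ↦ by positivity]
        congr 1
        · rw [← Finset.prod_filter, Finset.prod_const]
        · congr 1
          conv_rhs => rw [← Nat.prod_factorization_pow_eq_self hn]
          rw [Finsupp.prod, Nat.support_factorization]
          push_cast
          rfl
    _ ≤ K ^ P * (n : ℝ) ^ δ := by
        gcongr
        calc (n.primeFactors.filter (· < P)).card ≤ (Finset.range P).card := by
                refine Finset.card_le_card fun p hp ↦ ?_
                simpa using (Finset.mem_filter.mp hp).2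
            _ = P := Finset.card_range P

theorem card_divisorsAntidiag (n : ℤ) :
    n.divisorsAntidiag.card = 2 * n.natAbs.divisors.card := by
  rcases n with n | n <;>
    simp [Int.divisorsAntidiag, Finset.card_disjUnion, ← Nat.map_div_right_divisors, two_mul,
      -Finset.disjUnion_eq_union]

theorem ncard_triples_le {M N : ℕ} (hM : 0 < M) (hN : 0 < N) {D : ℝ} (hD : 0 ≤ D)
    (hdiv : ∀ n : ℤ, |n| ≤ 3 * M * N → (n.divisorsAntidiag.card : ℝ) ≤ D) :
    (Set.ncard {t : ℤ × ℤ × ℤ | |t.1| ≤ M ∧ |t.2.2| ≤ N ∧ t.1 * t.2.2 ≠ 0 ∧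
      |t.1 * t.2.2 - M * t.2.1| ≤ N} : ℝ) ≤ 15 * N ^ 2 * D := by
  let I : Finset (ℤ × ℤ) := Finset.Icc (-(2 * N : ℤ)) (2 * N) ×ˢ Finset.Icc (-(N : ℤ)) N
  let T : Finset (ℤ × ℤ × ℤ) := I.biUnion fun q ↦
    (M * q.1 + q.2 : ℤ).divisorsAntidiag.image fun p ↦ (p.1, q.1, p.2)
  have hM' : (1 : ℤ) ≤ M := by exact_mod_cast hM
  have hN' : (1 : ℤ) ≤ N := by exact_mod_cast hN
  have hsub : {t : ℤ × ℤ × ℤ | |t.1| ≤ M ∧ |t.2.2| ≤ N ∧ t.1 * t.2.2 ≠ 0 ∧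
      |t.1 * t.2.2 - M * t.2.1| ≤ N} ⊆ (T : Set (ℤ × ℤ × ℤ)) := by
    rintro ⟨v, x, z⟩ ⟨hv, hz, hvz, hm⟩
    simp only at hv hz hvz hm
    have h1 : |v * z| ≤ M * N := by rw [abs_mul]; gcongr
    have hx : |x| ≤ 2 * N := by
      refine le_of_mul_le_mul_left ?_ (by lia : (0 : ℤ) < M)
      calc (M : ℤ) * |x| = |v * z - (v * z - M * x)| := by
            rw [sub_sub_cancel, abs_mul, Nat.abs_cast]
        _ ≤ |v * z| + |v * z - M * x| := abs_sub _ _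
        _ ≤ M * (2 * N) := by nlinarith
    refine Finset.mem_biUnion.mpr ⟨(x, v * z - M * x), ?_, ?_⟩
    · exact Finset.mem_product.mpr
        ⟨Finset.mem_Icc.mpr (abs_le.mp hx), Finset.mem_Icc.mpr (abs_le.mp hm)⟩
    · exact Finset.mem_image.mpr
        ⟨(v, z), Int.mem_divisorsAntidiag.mpr ⟨by ring, by simpa using hvz⟩, rfl⟩
  have hT : (T.card : ℝ) ≤ I.card * D := by
    calc (T.card : ℝ) ≤ ∑ q ∈ I, ((M * q.1 + q.2 : ℤ).divisorsAntidiag.card : ℝ) := by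
          exact_mod_cast Finset.card_biUnion_le.trans
            (Finset.sum_le_sum fun _ _ ↦ Finset.card_image_le)
      _ ≤ ∑ _q ∈ I, D := by
          refine Finset.sum_le_sum fun q hq ↦ hdiv _ ?_
          obtain ⟨hx, hm⟩ := Finset.mem_product.mp hq
          have hx := abs_le.mpr (Finset.mem_Icc.mp hx)
          have hm := abs_le.mpr (Finset.mem_Icc.mp hm)
          calc |M * q.1 + q.2| ≤ |M * q.1| + |q.2| := abs_add_le _ _
            _ = M * |q.1| + |q.2| := by rw [abs_mul, Nat.abs_cast]
            _ ≤ 3 * M * N := by nlinarith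
      _ = I.card * D := by rw [Finset.sum_const, nsmul_eq_mul]
  have hI : (I.card : ℝ) ≤ 15 * N ^ 2 := by
    have h : I.card = (4 * N + 1) * (2 * N + 1) := by
      simp only [I, Finset.card_product, Int.card_Icc]
      congr 1 <;> lia
    rw [h]
    have : (1 : ℝ) ≤ N := by exact_mod_cast hN
    push_cast
    nlinarith
  calc _ ≤ (T.card : ℝ) := by
        rw [← Set.ncard_coe_finset T]
        exact_mod_cast Set.ncard_le_ncard hsub T.finite_toSet
    _ ≤ I.card * D := hT
    _ ≤ _ := by gcongr

theorem statement19 (ε : ℝ) (hε : 0 < ε) :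
    ∃ C : ℝ, 0 < C ∧
      ∀ M : ℕ, 0 < M → ∀ B L : ℝ, 1 ≤ L → L ≤ B → (M : ℝ) ≤ B ^ 3 →
        (Set.ncard {t : ℤ × ℤ × ℤ |
            ((|t.1| : ℤ) : ℝ) ≤ (M : ℝ) ∧
            1 ≤ |t.2.2| ∧ ((|t.2.2| : ℤ) : ℝ) ≤ B / L ∧
            t.1 * t.2.2 ≠ 0 ∧
            ((|t.1 * t.2.2 - (M : ℤ) * t.2.1| : ℤ) : ℝ) ≤ B / L} : ℝ)
          ≤ C * B ^ (2 + ε) / L ^ 2 := by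
  obtain ⟨C, hC, hdiv⟩ := exists_card_divisors_le_mul_rpow (δ := ε / 4) (by positivity)
  refine ⟨30 * C * 3 ^ (ε / 4), by positivity, ?_⟩
  intro M hM B L hL hLB hMB
  have hL0 : 0 < L := by linarith
  have hB0 : 0 < B := by linarith
  have hBL : 0 ≤ B / L := by positivity
  set N : ℕ := ⌊B / L⌋₊ with hN
  have hN1 : 0 < N := Nat.floor_pos.mpr ((one_le_div hL0).mpr hLB)
  have hNle : (N : ℝ) ≤ B / L := Nat.floor_le hBL
  have hNB : (N : ℝ) ≤ B := hNle.trans (div_le_self hB0.le hL)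
  have hfloor : ∀ a : ℤ, (a : ℝ) ≤ B / L → a ≤ N := fun a ha ↦ by
    rw [hN, Int.natCast_floor_eq_floor hBL]
    exact Int.le_floor.mpr ha
  have hD : ∀ n : ℤ, |n| ≤ 3 * M * N →
      (n.divisorsAntidiag.card : ℝ) ≤ 2 * (C * (3 ^ (ε / 4) * B ^ ε)) := by
    intro n hn
    rcases eq_or_ne n 0 with rfl | hn0
    · simp only [Int.divisorsAntidiag_zero, Finset.card_empty, Nat.cast_zero]
      positivity
    have hnB : (n.natAbs : ℝ) ≤ 3 * B ^ 4 := by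
      calc (n.natAbs : ℝ) ≤ 3 * M * N := by
            rw [Nat.cast_natAbs]; exact_mod_cast hn
        _ ≤ 3 * B ^ 3 * B := by gcongr
        _ = 3 * B ^ 4 := by ring
    calc (n.divisorsAntidiag.card : ℝ) = 2 * n.natAbs.divisors.card := by
          exact_mod_cast card_divisorsAntidiag n
      _ ≤ 2 * (C * (n.natAbs : ℝ) ^ (ε / 4)) := by
          gcongr
          exact hdiv _ (Int.natAbs_ne_zero.mpr hn0)
      _ ≤ 2 * (C * (3 * B ^ 4) ^ (ε / 4)) := by gcongr
      _ = 2 * (C * (3 ^ (ε / 4) * B ^ ε)) := by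
          rw [Real.mul_rpow (by norm_num) (by positivity), ← Real.rpow_natCast B 4,
            ← Real.rpow_mul hB0.le]
          congr 4
          push_cast
          ring
  have hset : {t : ℤ × ℤ × ℤ |
      ((|t.1| : ℤ) : ℝ) ≤ (M : ℝ) ∧
      1 ≤ |t.2.2| ∧ ((|t.2.2| : ℤ) : ℝ) ≤ B / L ∧
      t.1 * t.2.2 ≠ 0 ∧
      ((|t.1 * t.2.2 - (M : ℤ) * t.2.1| : ℤ) : ℝ) ≤ B / L} =
      {t : ℤ × ℤ × ℤ | |t.1| ≤ M ∧ |t.2.2| ≤ N ∧ t.1 * t.2.2 ≠ 0 ∧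
        |t.1 * t.2.2 - M * t.2.1| ≤ N} := by
    have hiff : ∀ a : ℤ, (a : ℝ) ≤ B / L ↔ a ≤ N := fun a ↦
      ⟨hfloor a, fun h ↦ le_trans (by exact_mod_cast h) hNle⟩
    ext t
    simp only [Set.mem_ofPred_eq, hiff]
    refine ⟨fun ⟨h1, _, h3⟩ ↦ ⟨by exact_mod_cast h1, h3⟩,
      fun ⟨h1, h2, h3, h4⟩ ↦ ⟨by exact_mod_cast h1, ?_, h2, h3, h4⟩⟩
    exact Int.one_le_abs (right_ne_zero_of_mul h3)
  rw [hset]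
  calc _ ≤ 15 * (N : ℝ) ^ 2 * (2 * (C * (3 ^ (ε / 4) * B ^ ε))) :=
        ncard_triples_le hM hN1 (by positivity) hD
    _ ≤ 15 * (B / L) ^ 2 * (2 * (C * (3 ^ (ε / 4) * B ^ ε))) := by gcongr
    _ = 30 * C * 3 ^ (ε / 4) * B ^ (2 + ε) / L ^ 2 := by
        rw [Real.rpow_add hB0, Real.rpow_two]
        ring
end
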